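/- arXiv:2006.14695 — 6 statements merged into one kernel-verified Lean document; each statement's English description precedes it below -/
import Mathlib

section
/- Let m ≥ 1 and let (B, B̄, i, j) be a framed representation of the doubled cyclic quiver with m vertices, dimension vector (1,…,1) and one-dimensional framing at vertex 0, which is T′-fixed up to gauge. Then every nontrivial cycle in the quiver vanishes: B̄_{k+1}·B_k = 0 for every k ∈ ℤ/m, ∏_{k∈ℤ/m} B_k = 0, and ∏_{k∈ℤ/m} B̄_k = 0. -/
open scoped BigOperators

/-- A framed representation `(B, B̄, i, j)` of the doubled cyclic quiver with `m` vertices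
(indexed by `ZMod m`), dimension vector `(1,…,1)` and one-dimensional framing at vertex `0`,
is taken by the torus element `(x, y)` to its gauge transform by `g ∈ (ℂ^×)^m`:
`x·B_k = (g_{k+1}/g_k)·B_k`, `y·B̄_k = (g_{k−1}/g_k)·B̄_k`, `i = g_0·i`,
`x·y·j = g_0⁻¹·j`. -/
def GaugeFix (m : ℕ) (B Bbar : ZMod m → ℂ) (i j : ℂ) (x y : ℂ) (g : ZMod m → ℂ) : Prop :=
  (∀ k, g k ≠ 0) ∧
  (∀ k, x * B k = g (k + 1) / g k * B k) ∧
  (∀ k, y * Bbar k = g (k - 1) / g k * Bbar k) ∧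
  i = g 0 * i ∧ x * y * j = (g 0)⁻¹ * j

/-- If a framed representation of the doubled cyclic quiver with `m ≥ 1` vertices,
dimension vector `(1,…,1)` and one-dimensional framing at vertex `0` is `T′`-fixed up to
gauge, then every nontrivial cycle in the quiver vanishes: `B̄_{k+1}·B_k = 0` for every
`k ∈ ℤ/m`, `∏_k B_k = 0`, and `∏_k B̄_k = 0`. -/
theorem cycles_vanish_of_torus_fixed (m : ℕ) [NeZero m]
    (B Bbar : ZMod m → ℂ) (i j : ℂ)
    (hfix : ∀ x y : ℂ, x ≠ 0 → y ≠ 0 → ∃ g : ZMod m → ℂ, GaugeFix m B Bbar i j x y g) :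
    (∀ k : ZMod m, Bbar (k + 1) * B k = 0) ∧
    (∏ k : ZMod m, B k) = 0 ∧ (∏ k : ZMod m, Bbar k) = 0 := by
  obtain ⟨g, hg, h1, h2, -, -⟩ := hfix 2 2 two_ne_zero two_ne_zero
  have hm : (2 : ℂ) ^ m ≠ 1 := by
    have h : (2 : ℕ) ^ m ≠ 1 := (Nat.one_lt_two_pow (NeZero.ne m)).ne'
    exact_mod_cast h
  have hP : (∏ k : ZMod m, g k) ≠ 0 := Finset.prod_ne_zero_iff.mpr fun k _ => hg k
  have key : ∀ (C : ZMod m → ℂ) (e : ZMod m ≃ ZMod m),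
      (∀ k, 2 * C k = g (e k) / g k * C k) → (∏ k : ZMod m, C k) = 0 := by
    intro C e h
    have h3 : (∏ k : ZMod m, 2 * C k) = ∏ k : ZMod m, g (e k) / g k * C k :=
      Finset.prod_congr rfl fun k _ => h k
    rw [Finset.prod_mul_distrib, Finset.prod_mul_distrib, Finset.prod_div_distrib,
      Equiv.prod_comp e g, div_self hP, Finset.prod_const, Finset.card_univ, ZMod.card] at h3
    by_contra hC
    exact hm (mul_right_cancel₀ hC h3)
  refine ⟨fun k => ?_, key B (Equiv.addRight 1) (fun k => by simpa using h1 k),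
    key Bbar (Equiv.subRight 1) (fun k => by simpa using h2 k)⟩
  have a := h1 k
  have b := h2 (k + 1)
  rw [add_sub_cancel_right] at b
  have c : (2 * Bbar (k + 1)) * (2 * B k) = Bbar (k + 1) * B k := by
    rw [a, b]
    have := hg k
    have := hg (k + 1)
    field_simp
  linear_combination c / 3
end

section
/- Let m ≥ 1 and let (B, B̄, i, j) be a framed representation of the doubled cyclic quiver with m vertices, dimension vector (1,…,1) and one-dimensional framing at vertex 0, satisfying the moment map equations, generated by the framing, and T′-fixed up to gauge. Then j = 0, and there is a unique a ∈ {0,…,m−1} such that {k ∈ ℤ/m : B_k ≠ 0} = {0, 1, …, a−1} and {k ∈ ℤ/m : B̄_k ≠ 0} = {0, m−1, m−2, …, a+2} (this set being empty when a = m−1 and equal to {0} when a = m−2). Moreover, for each (x,y) ∈ (ℂ^×)² the gauge element g with g_0 = 1 realizing the fixedness is unique and is given by g_k = x^k for 0 ≤ k ≤ a and g_k = y^{m−k} for a < k ≤ m−1; that is, the T′-character of the fixed representation is the m-hook y^{m−1−a} + ⋯ + y + 1 + x + ⋯ + x^{a}. -/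
open scoped BigOperators

/-- The representation is generated by the framing: `i ≠ 0` and every vertex is reached
from vertex `0` by a directed path of arrows (each `B`-step goes `k → k+1`, each
`B̄`-step goes `k → k−1`) all of whose scalars are nonzero. -/
def GeneratedByFraming (m : ℕ) (B Bbar : ZMod m → ℂ) (i : ℂ) : Prop :=
  i ≠ 0 ∧ ∀ k : ZMod m, ∃ n : ℕ, ∃ p : Fin (n + 1) → ZMod m,
    p 0 = 0 ∧ p (Fin.last n) = k ∧
    ∀ t : Fin n,
      (p t.succ = p t.castSucc + 1 ∧ B (p t.castSucc) ≠ 0) ∨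
      (p t.succ = p t.castSucc - 1 ∧ Bbar (p t.castSucc) ≠ 0)

theorem hk_pow_ne (a c : ℕ) (hc : 0 < c) : (2:ℂ) ^ a ≠ 3 ^ c := by
  intro h
  have h' : (2:ℕ) ^ a = 3 ^ c := by exact_mod_cast h
  rcases Nat.eq_zero_or_pos a with rfl | ha
  · have := Nat.one_lt_pow hc.ne' (show 1 < 3 by norm_num)
    simp at h'
    omega
  · have h1 : Even (2 ^ a) := (Nat.even_pow.2 ⟨even_two, ha.ne'⟩)
    have h2 : Odd (3 ^ c) := Odd.pow (by decide)
    rw [h'] at h1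
    exact (Nat.not_even_iff_odd.2 h2) h1

theorem hk_max (P : ℕ → Prop) (m : ℕ) (h0 : P 0) (hm : ¬ P m) : ∃ a, P a ∧ ¬ P (a + 1) := by
  by_contra hc
  push Not at hc
  exact hm (Nat.rec h0 hc m)

theorem hk_gP {m : ℕ} {B Bbar : ZMod m → ℂ} {i j x y : ℂ} {g : ZMod m → ℂ}
    (hg : GaugeFix m B Bbar i j x y g) (h0 : g 0 = 1) (n : ℕ)
    (hP : ∀ l < n, B (l : ZMod m) ≠ 0) : g (n : ZMod m) = x ^ n := by
  induction n with
  | zero => simpa using h0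
  | succ n ih =>
    have e := mul_right_cancel₀ (hP n (by omega)) (hg.2.1 n)
    rw [eq_div_iff (hg.1 _), ih (fun l hl => hP l (by omega))] at e
    push_cast
    rw [← e]; ring

theorem hk_gQ {m : ℕ} {B Bbar : ZMod m → ℂ} {i j x y : ℂ} {g : ZMod m → ℂ}
    (hg : GaugeFix m B Bbar i j x y g) (h0 : g 0 = 1) (n : ℕ)
    (hQ : ∀ l < n, Bbar (-(l : ZMod m)) ≠ 0) : g (-(n : ZMod m)) = y ^ n := by
  induction n with
  | zero => simpa using h0
  | succ n ih =>
    have e := mul_right_cancel₀ (hQ n (by omega)) (hg.2.2.1 _)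
    rw [eq_div_iff (hg.1 _), ih (fun l hl => hQ l (by omega))] at e
    have : (-((n + 1 : ℕ) : ZMod m)) = -(n : ZMod m) - 1 := by push_cast; ring
    rw [this, ← e]; ring

/-- A framed representation of the doubled cyclic quiver with `m ≥ 1` vertices, dimension
vector `(1,…,1)` and one-dimensional framing at vertex `0`, satisfying the moment map
equations, generated by the framing, and `T′`-fixed up to gauge, has `j = 0`, and there is
a unique `a ∈ {0,…,m−1}` with `{k : B_k ≠ 0} = {0,…,a−1}` and
`{k : B̄_k ≠ 0} = {0, m−1, m−2, …, a+2}` (described as the residues of integers `l` with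
`a+2 ≤ l ≤ m`).  Moreover for each `(x,y) ∈ (ℂ^×)²` the gauge element `g` with `g_0 = 1`
realizing the fixedness is unique and is given by `g_k = x^k` for `0 ≤ k ≤ a` and
`g_k = y^{m−k}` for `a < k ≤ m−1`, i.e. the `T′`-character of the fixed representation is
the `m`-hook `y^{m−1−a} + ⋯ + y + 1 + x + ⋯ + x^a`. -/
theorem torus_fixed_framed_reps_are_hooks (m : ℕ) [NeZero m]
    (B Bbar : ZMod m → ℂ) (i j : ℂ)
    (hmom : ∀ k : ZMod m,
      Bbar (k + 1) * B k - B (k - 1) * Bbar k + (if k = 0 then i * j else 0) = 0)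
    (hgen : GeneratedByFraming m B Bbar i)
    (hfix : ∀ x y : ℂ, x ≠ 0 → y ≠ 0 → ∃ g : ZMod m → ℂ, GaugeFix m B Bbar i j x y g) :
    j = 0 ∧
    ∃! a : ℕ, a < m ∧
      ({k : ZMod m | B k ≠ 0} = {k : ZMod m | ∃ l : ℕ, l < a ∧ k = (l : ZMod m)}) ∧
      ({k : ZMod m | Bbar k ≠ 0} =
        {k : ZMod m | ∃ l : ℕ, a + 2 ≤ l ∧ l ≤ m ∧ k = (l : ZMod m)}) ∧
      ∀ x y : ℂ, x ≠ 0 → y ≠ 0 →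
        (∃! g : ZMod m → ℂ, g 0 = 1 ∧ GaugeFix m B Bbar i j x y g) ∧
        ∀ g : ZMod m → ℂ, g 0 = 1 → GaugeFix m B Bbar i j x y g →
          (∀ k : ℕ, k ≤ a → g (k : ZMod m) = x ^ k) ∧
          (∀ k : ℕ, a < k → k ≤ m - 1 → g (k : ZMod m) = y ^ (m - k)) := by
  obtain ⟨hi, hpath⟩ := hgen
  have hg0 : ∀ x y g, GaugeFix m B Bbar i j x y g → g 0 = 1 := by
    intro x y g hg
    have h := hg.2.2.2.1
    exact (mul_right_cancel₀ hi (by rw [one_mul]; exact h)).symm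
  obtain ⟨g, hg⟩ := hfix 2 3 (by norm_num) (by norm_num)
  have hg1 := hg0 _ _ _ hg
  have hmpos : 0 < m := Nat.pos_of_ne_zero (NeZero.ne m)
  have hj : j = 0 := by
    have h := hg.2.2.2.2
    rw [hg1] at h
    norm_num at h
    by_contra hne
    have h6 := mul_right_cancel₀ hne (h.trans (one_mul j).symm)
    norm_num at h6
  refine ⟨hj, ?_⟩
  -- no back and forth
  have hno : ∀ k, B k ≠ 0 → Bbar (k + 1) ≠ 0 → False := by
    intro k h1 h2
    have e1 := mul_right_cancel₀ h1 (hg.2.1 _)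
    have e2 := mul_right_cancel₀ h2 (hg.2.2.1 _)
    rw [eq_div_iff (hg.1 _)] at e1 e2
    rw [add_sub_cancel_right, ← e1] at e2
    have : (5:ℂ) * g k = 0 := by linear_combination e2
    simp [hg.1 k] at this
  set P : ℕ → Prop := fun n => ∀ l < n, B (l : ZMod m) ≠ 0 with hPdef
  set Q : ℕ → Prop := fun n => ∀ l < n, Bbar (-(l : ZMod m)) ≠ 0 with hQdef
  have hreach : ∀ k : ZMod m, ∃ n : ℕ, (P n ∧ k = n) ∨ (Q n ∧ k = -(n : ZMod m)) := by
    intro k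
    obtain ⟨N, p, hp0, hpN, hstep⟩ := hpath k
    rw [← hpN]
    suffices h : ∀ t : Fin (N + 1), ∃ n : ℕ, (P n ∧ p t = n) ∨ (Q n ∧ p t = -(n : ZMod m)) from h _
    intro t
    induction t using Fin.induction with
    | zero => exact ⟨0, Or.inl ⟨fun l hl => absurd hl (by omega), by simp [hp0]⟩⟩
    | succ t ih =>
      obtain ⟨n, ⟨hn, he⟩ | ⟨hn, he⟩⟩ := ih
      · rcases hstep t with ⟨h1, h2⟩ | ⟨h1, h2⟩
        · refine ⟨n + 1, Or.inl ⟨fun l hl => ?_, by rw [h1, he]; push_cast; ring⟩⟩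
          rcases Nat.lt_succ_iff_lt_or_eq.1 hl with h | rfl
          · exact hn l h
          · rwa [← he]
        · rcases n with _ | n
          · refine ⟨1, Or.inr ⟨fun l hl => ?_, by rw [h1, he]; simp⟩⟩
            obtain rfl : l = 0 := by omega
            rw [he] at h2
            simpa using h2
          · exfalso
            refine hno n (hn n (by omega)) ?_
            rw [he] at h2
            simpa using h2
      · rcases hstep t with ⟨h1, h2⟩ | ⟨h1, h2⟩
        · rcases n with _ | n
          · refine ⟨1, Or.inl ⟨fun l hl => ?_, by rw [h1, he]; simp⟩⟩
            obtain rfl : l = 0 := by omega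
            rw [he] at h2
            simpa using h2
          · exfalso
            refine hno _ h2 ?_
            have : p t.castSucc + 1 = -(n : ZMod m) := by rw [he]; push_cast; ring
            rw [this]
            exact hn n (by omega)
        · refine ⟨n + 1, Or.inr ⟨fun l hl => ?_, by rw [h1, he]; push_cast; ring⟩⟩
          rcases Nat.lt_succ_iff_lt_or_eq.1 hl with h | rfl
          · exact hn l h
          · rwa [← he]
  have hPm : ¬ P m := by
    intro h
    have := hk_gP hg hg1 m h
    rw [ZMod.natCast_self, hg1] at this
    have h2 : (1:ℕ) = 2 ^ m := by exact_mod_cast this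
    have := Nat.one_lt_pow hmpos.ne' (show 1 < 2 by norm_num)
    omega
  have hQm : ¬ Q m := by
    intro h
    have := hk_gQ hg hg1 m h
    rw [ZMod.natCast_self, neg_zero, hg1] at this
    have h2 : (1:ℕ) = 3 ^ m := by exact_mod_cast this
    have := Nat.one_lt_pow hmpos.ne' (show 1 < 3 by norm_num)
    omega
  have hPmono : ∀ n n', n ≤ n' → P n' → P n := fun n n' h hp l hl => hp l (by omega)
  have hQmono : ∀ n n', n ≤ n' → Q n' → Q n := fun n n' h hp l hl => hp l (by omega)
  obtain ⟨a, hPa, hPa'⟩ := hk_max P m (fun l hl => absurd hl (by omega)) hPm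
  obtain ⟨b, hQb, hQb'⟩ := hk_max Q m (fun l hl => absurd hl (by omega)) hQm
  have hPle : ∀ n, P n → n ≤ a := fun n hn => by
    by_contra h; exact hPa' (hPmono _ _ (by omega) hn)
  have hQle : ∀ n, Q n → n ≤ b := fun n hn => by
    by_contra h; exact hQb' (hQmono _ _ (by omega) hn)
  have ham : a < m := by by_contra h; exact hPm (hPmono _ _ (by omega) hPa)
  have hbm : b < m := by by_contra h; exact hQm (hQmono _ _ (by omega) hQb)
  have hBa : B (a : ZMod m) = 0 := by
    by_contra h
    refine hPa' fun l hl => ?_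
    rcases Nat.lt_succ_iff_lt_or_eq.1 hl with h' | rfl
    · exact hPa l h'
    · exact h
  have hBb : Bbar (-(b : ZMod m)) = 0 := by
    by_contra h
    refine hQb' fun l hl => ?_
    rcases Nat.lt_succ_iff_lt_or_eq.1 hl with h' | rfl
    · exact hQb l h'
    · exact h
  have hinj : ∀ n n' : ℕ, n < m → n' < m → (n : ZMod m) = n' → n = n' := by
    intro n n' h h' e
    rw [ZMod.natCast_eq_natCast_iff] at e
    exact Nat.ModEq.eq_of_lt_of_lt e h h'
  have hsub : ∀ n : ℕ, n ≤ m → ((m - n : ℕ) : ZMod m) = -(n : ZMod m) := by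
    intro n hn
    rw [Nat.cast_sub hn]; simp
  have hab : a + b + 1 = m := by
    rcases lt_trichotomy (a + b + 1) m with h | h | h
    · exfalso
      obtain ⟨n, ⟨hn, he⟩ | ⟨hn, he⟩⟩ := hreach ((a + 1 : ℕ) : ZMod m)
      · have := hPle n hn
        have := hinj _ _ (by omega) (by omega) he
        omega
      · have := hQle n hn
        have hz : ((a + 1 + n : ℕ) : ZMod m) = ((0 : ℕ) : ZMod m) := by
          rw [Nat.cast_add, he]; simp
        have := hinj _ _ (by omega) (by omega) hz
        omega
    · exact h
    · exfalso
      have h1 := hk_gP hg hg1 a hPa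
      have h2 := hk_gQ hg hg1 (m - a) (hQmono _ _ (by omega) hQb)
      rw [hsub a ham.le, neg_neg, h1] at h2
      exact hk_pow_ne _ _ (by omega) h2
  have hcov : ∀ k : ZMod m, (∃ n : ℕ, n ≤ a ∧ k = n) ∨ (∃ n : ℕ, n ≤ b ∧ k = -(n : ZMod m)) := by
    intro k
    obtain ⟨n, ⟨hn, he⟩ | ⟨hn, he⟩⟩ := hreach k
    · exact Or.inl ⟨n, hPle n hn, he⟩
    · exact Or.inr ⟨n, hQle n hn, he⟩
  have hBset : {k : ZMod m | B k ≠ 0} = {k : ZMod m | ∃ l : ℕ, l < a ∧ k = (l : ZMod m)} := by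
    ext k
    simp only [Set.mem_setOf_eq]
    constructor
    · intro hk
      rcases hcov k with ⟨n, hn, rfl⟩ | ⟨n, hn, rfl⟩
      · refine ⟨n, lt_of_le_of_ne hn ?_, rfl⟩
        rintro rfl
        exact hk hBa
      · rcases n with _ | n
        · refine ⟨0, Nat.pos_of_ne_zero ?_, by simp⟩
          rintro rfl
          exact hk (by simpa using hBa)
        · exfalso
          refine hno _ hk ?_
          have : -((n + 1 : ℕ) : ZMod m) + 1 = -(n : ZMod m) := by push_cast; ring
          rw [this]
          exact hQb n (by omega)
    · rintro ⟨l, hl, rfl⟩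
      exact hPa l hl
  have hBbset : {k : ZMod m | Bbar k ≠ 0} =
      {k : ZMod m | ∃ l : ℕ, a + 2 ≤ l ∧ l ≤ m ∧ k = (l : ZMod m)} := by
    ext k
    simp only [Set.mem_setOf_eq]
    constructor
    · intro hk
      have key : ∀ n : ℕ, n ≤ b → k = -(n : ZMod m) →
          ∃ l : ℕ, a + 2 ≤ l ∧ l ≤ m ∧ k = (l : ZMod m) := by
        rintro n hn rfl
        have : n ≠ b := by
          rintro rfl
          exact hk hBb
        exact ⟨m - n, by omega, by omega, (hsub n (by omega)).symm⟩
      rcases hcov k with ⟨n, hn, he⟩ | ⟨n, hn, he⟩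
      · rcases n with _ | n
        · exact key 0 (by omega) (by simpa using he)
        · exfalso
          refine hno n (hPa n (by omega)) ?_
          rw [he] at hk
          simpa using hk
      · exact key n hn he
    · rintro ⟨l, hl, hl', rfl⟩
      have := hsub (m - l) (by omega)
      rw [Nat.sub_sub_self hl'] at this
      rw [this]
      exact hQb _ (by omega)
  have hform : ∀ x y : ℂ, ∀ g : ZMod m → ℂ, GaugeFix m B Bbar i j x y g →
      (∀ k : ℕ, k ≤ a → g (k : ZMod m) = x ^ k) ∧
      (∀ k : ℕ, k ≤ b → g (-(k : ZMod m)) = y ^ k) := by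
    intro x y g hg
    exact ⟨fun k hk => hk_gP hg (hg0 _ _ _ hg) k (hPmono _ _ hk hPa),
      fun k hk => hk_gQ hg (hg0 _ _ _ hg) k (hQmono _ _ hk hQb)⟩
  refine ⟨a, ⟨ham, hBset, hBbset, ?_⟩, ?_⟩
  · intro x y hx hy
    constructor
    · obtain ⟨g', hg'⟩ := hfix x y hx hy
      refine ⟨g', ⟨hg0 _ _ _ hg', hg'⟩, ?_⟩
      rintro g'' ⟨-, hg''⟩
      funext k
      rcases hcov k with ⟨n, hn, rfl⟩ | ⟨n, hn, rfl⟩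
      · rw [(hform _ _ _ hg').1 n hn, (hform _ _ _ hg'').1 n hn]
      · rw [(hform _ _ _ hg').2 n hn, (hform _ _ _ hg'').2 n hn]
    · intro g' _ hg'
      refine ⟨(hform _ _ _ hg').1, fun k hk hk' => ?_⟩
      have h1 := (hform _ _ _ hg').2 (m - k) (by omega)
      rwa [← hsub (m - k) (by omega), Nat.sub_sub_self (by omega)] at h1
  · rintro a' ⟨ha', hB', -, -⟩
    rw [hBset] at hB'
    rcases lt_trichotomy a' a with h | h | h
    · exfalso
      have : (a' : ZMod m) ∈ {k : ZMod m | ∃ l : ℕ, l < a ∧ k = (l : ZMod m)} := ⟨a', h, rfl⟩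
      rw [hB'] at this
      obtain ⟨l, hl, he⟩ := this
      have := hinj _ _ (by omega) (by omega) he
      omega
    · exact h
    · exfalso
      have : (a : ZMod m) ∈ {k : ZMod m | ∃ l : ℕ, l < a' ∧ k = (l : ZMod m)} := ⟨a, h, rfl⟩
      rw [← hB'] at this
      obtain ⟨l, hl, he⟩ := this
      have := hinj _ _ (by omega) (by omega) he
      omega
end

section
/- Let m ≥ 1, let vec λ = (λ_0,…,λ_{m−1}) be an m-tuple of partitions with box set B(vec λ), weight map wt and color map c, and let d : B(vec λ) → ℤ be any function (the degrees of a torus-fixed quasimap to Hilb(A_{m−1})). Define χ : ℤ → ℤ[q, q^{−1}] by χ(n) := Σ_{k=0}^{n} q^{−k} for n ≥ 0 and χ(n) := −Σ_{k=1}^{−n−1} q^{k} for n < 0. In ℤ[x^{±1}, y^{±1}, q^{±1}] set T := Σ_{v : c(v)=0} x^{wt(v)_1} y^{wt(v)_2} χ(d(v)) + Σ_{v : c(v)=0} x^{−wt(v)_1−1} y^{−wt(v)_2−1} χ(−d(v)) + Σ_{(v,v′) : c(v′)=c(v)+1} ( x^{wt(v′)_1−wt(v)_1−1} y^{wt(v′)_2−wt(v)_2}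 χ(d(v′)−d(v)) + x^{wt(v)_1−wt(v′)_1} y^{wt(v)_2−wt(v′)_2−1} χ(d(v)−d(v′)) ) − Σ_{(v,v′) : c(v′)=c(v)} ( x^{wt(v′)_1−wt(v)_1} y^{wt(v′)_2−wt(v)_2} χ(d(v′)−d(v)) + x^{wt(v)_1−wt(v′)_1−1} y^{wt(v)_2−wt(v′)_2−1} χ(d(v)−d(v′)) ), where all pair-sums run over ordered pairs of elements of B(vec λ) satisfying the stated color condition (colors taken mod m). Then the coefficient of x^0 y^0 q^0 in T equals N1 − N2 − N3, where N1 is the number of ordered pairs (v,v′) with wt(v′) − wt(v) ∈ {(0,0), (1,1)} and d(v) > d(v′), N2 is the number of ordered pairs (v,v′) with wt(v′) − wt(v) ∈ {(1,0), (0,1)} and d(v) > d(v′), and N3 is the number of v with wt(v) = (0,0) and d(v) < 0. -/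
open scoped BigOperators Classical

/-- `f` represents a partition `λ` via `λ_i = f i` for `i ≥ 1` (weakly decreasing with
finitely many nonzero terms, normalized by `f 0 = 0`). -/
def IsPartition (f : ℕ → ℕ) : Prop :=
  (∀ i j : ℕ, 1 ≤ i → i ≤ j → f j ≤ f i) ∧ (∃ N, ∀ n, N ≤ n → f n = 0) ∧ f 0 = 0

/-- Membership in the `m`-hook at `a`:
`H_a = {(k,0) : 0 ≤ k ≤ a} ∪ {(0,l) : 1 ≤ l ≤ m−1−a} ⊂ ℤ²`. -/
def HookMem (m a : ℕ) (h : ℤ × ℤ) : Prop :=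
  (∃ k : ℕ, k ≤ a ∧ h = ((k : ℤ), 0)) ∨ (∃ l : ℕ, 1 ≤ l ∧ l + a + 1 ≤ m ∧ h = (0, (l : ℤ)))

/-- The box set `B(vec λ)` of an `m`-tuple of partitions: boxes are `(a, p, q, h)` with
`(p,q)` a cell of the Young diagram `D_a` (i.e. `q + 1 ≤ (λ_a)_{p+1}`) and `h ∈ H_a`. -/
def InBoxSet (m : ℕ) (lam : Fin m → ℕ → ℕ) (v : Fin m × ℕ × ℕ × ℤ × ℤ) : Prop :=
  v.2.2.1 + 1 ≤ lam v.1 (v.2.1 + 1) ∧ HookMem m v.1.val v.2.2.2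

/-- The weight `wt(a,p,q,h) = p·(a+1, a+1−m) + q·(−a, m−a) + h ∈ ℤ²` of a box. -/
def wt (m : ℕ) (v : Fin m × ℕ × ℕ × ℤ × ℤ) : ℤ × ℤ :=
  ((v.2.1 : ℤ) * ((v.1.val : ℤ) + 1) - (v.2.2.1 : ℤ) * (v.1.val : ℤ) + v.2.2.2.1,
   (v.2.1 : ℤ) * ((v.1.val : ℤ) + 1 - (m : ℤ)) +
     (v.2.2.1 : ℤ) * ((m : ℤ) - (v.1.val : ℤ)) + v.2.2.2.2)

/-- The color `c(v) = (wt(v)_1 − wt(v)_2) mod m` of a box. -/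
def color (m : ℕ) (v : Fin m × ℕ × ℕ × ℤ × ℤ) : ZMod m :=
  (((wt m v).1 - (wt m v).2 : ℤ) : ZMod m)

/-- `x^a y^b χ(n)` as a Laurent "polynomial", an element of `(ℤ×ℤ×ℤ) →₀ ℤ` recording
coefficients of `x^{e₁} y^{e₂} q^{e₃}`; here `χ(n) = Σ_{k=0}^{n} q^{−k}` for `n ≥ 0` and
`χ(n) = −Σ_{k=1}^{−n−1} q^{k}` for `n < 0`. -/
noncomputable def chiAt (a b n : ℤ) : (ℤ × ℤ × ℤ) →₀ ℤ :=
  if 0 ≤ n then ∑ k ∈ Finset.range (n.toNat + 1), Finsupp.single (a, b, -(k : ℤ)) 1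
  else -∑ k ∈ Finset.range ((-n).toNat - 1), Finsupp.single (a, b, (k : ℤ) + 1) 1

lemma aux_chi (a b n : ℤ) :
    chiAt a b n (0, 0, 0) = if a = 0 ∧ b = 0 ∧ 0 ≤ n then 1 else 0 := by
  unfold chiAt
  by_cases hn : 0 ≤ n
  · rw [if_pos hn, Finsupp.finsetSum_apply]
    by_cases hab : a = 0 ∧ b = 0
    · obtain ⟨rfl, rfl⟩ := hab
      rw [Finset.sum_eq_single 0]
      · simp [hn]
      · intro k _ hk
        rw [Finsupp.single_apply, if_neg]
        intro h
        simp only [Prod.mk.injEq] at h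
        omega
      · intro h
        simp at h
    · rw [if_neg (by tauto)]
      apply Finset.sum_eq_zero
      intro k _
      rw [Finsupp.single_apply, if_neg]
      intro h
      simp only [Prod.mk.injEq] at h
      tauto
  · rw [if_neg hn, if_neg (by tauto), Finsupp.neg_apply, Finsupp.finsetSum_apply, neg_eq_zero]
    apply Finset.sum_eq_zero
    intro k _
    rw [Finsupp.single_apply, if_neg]
    intro h
    simp only [Prod.mk.injEq] at h
    omega

/-- The element of the hook at `a` of color `c`, for `0 ≤ c ≤ m`. -/
def etaH (m a c : ℕ) : ℤ × ℤ := if c ≤ a then ((c : ℤ), 0) else (0, (m : ℤ) - c)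

lemma etaH_content (m a c : ℕ) :
    (etaH m a c).1 - (etaH m a c).2 = c ∨ (etaH m a c).1 - (etaH m a c).2 = (c : ℤ) - m := by
  unfold etaH
  split_ifs <;> simp

lemma etaH_zero (m a : ℕ) : etaH m a 0 = (0, 0) := by simp [etaH]

lemma etaH_m (m a : ℕ) (h : a < m) : etaH m a m = (0, 0) := by
  unfold etaH
  rw [if_neg (by omega)]
  simp

lemma etaH_mem (m a : ℕ) (ha : a < m) (h : ℤ × ℤ) :
    HookMem m a h ↔ ∃ c, c < m ∧ etaH m a c = h := by
  constructor
  · rintro (⟨k, hk, rfl⟩ | ⟨l, h1, h2, rfl⟩)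
    · exact ⟨k, by omega, by simp [etaH, hk]⟩
    · refine ⟨m - l, by omega, ?_⟩
      unfold etaH
      rw [if_neg (by omega)]
      ext <;> simp
      omega
  · rintro ⟨c, hc, rfl⟩
    unfold etaH
    split_ifs with h
    · exact Or.inl ⟨c, h, rfl⟩
    · refine Or.inr ⟨m - c, by omega, by omega, ?_⟩
      ext <;> simp
      omega

lemma etaH_inj (m a c c' : ℕ) (hc : c < m) (hc' : c' < m) (h : etaH m a c = etaH m a c') :
    c = c' := by
  have h1 := etaH_content m a c
  have h2 := etaH_content m a c'
  rw [h] at h1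
  omega

lemma small_mult (m : ℕ) (x z : ℤ) (h : x = m * z) (h1 : x < m) (h2 : -(m : ℤ) < x) : x = 0 := by
  by_contra hx
  have : (m : ℤ) ∣ x := ⟨z, h⟩
  have := Int.eq_zero_of_abs_lt_dvd this (by rw [abs_lt]; omega)
  exact hx this

/-- A sum over a hook constrained to one color. -/
lemma hook_single (m a c : ℕ) (ha : a < m) (hc : c ≤ m) (P : ℤ × ℤ → Prop) [DecidablePred P]
    (hP : ∀ w, P w → ∃ z : ℤ, w.1 - w.2 = c + m * z) :
    ∑ c' ∈ Finset.range m, (if P (etaH m a c') then (1 : ℤ) else 0)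
      = if P (etaH m a c) then 1 else 0 := by
  have key : ∀ c₀, c₀ < m → etaH m a c₀ = etaH m a c → (c₀ = c ∨ c₀ + m = c) →
      ∑ c' ∈ Finset.range m, (if P (etaH m a c') then (1 : ℤ) else 0)
      = if P (etaH m a c) then 1 else 0 := by
    intro c₀ h0 he hcc
    rw [Finset.sum_eq_single c₀, he]
    · intro c' hc' hne
      rw [if_neg]
      intro hp
      obtain ⟨z, hz⟩ := hP _ hp
      rw [Finset.mem_range] at hc'
      have h1 := etaH_content m a c'
      apply hne
      have : ∃ y : ℤ, (c' : ℤ) - c₀ = m * y := by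
        rcases h1 with h1 | h1 <;> rcases hcc with h2 | h2
        · exact ⟨z, by omega⟩
        · exact ⟨z + 1, by rw [mul_add]; omega⟩
        · exact ⟨z + 1, by rw [mul_add]; omega⟩
        · exact ⟨z + 2, by rw [mul_add]; omega⟩
      obtain ⟨y, hy⟩ := this
      have := small_mult m _ y hy (by omega) (by omega)
      omega
    · intro h
      simp [h0] at h
  by_cases h : c < m
  · exact key c h rfl (Or.inl rfl)
  · have : c = m := by omega
    subst this
    exact key 0 (by omega) (by rw [etaH_zero, etaH_m _ _ ha]) (Or.inr (by omega))

/-- The summand in the telescoping sum. -/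
def termK (m a b : ℕ) (φ : ℤ → ℤ → ℤ) (c : ℕ) : ℤ :=
  φ ((etaH m b c).1 - (etaH m a c).1) ((etaH m b c).2 - (etaH m a c).2)
  + φ ((etaH m b c).1 - (etaH m a c).1 - 1) ((etaH m b c).2 - (etaH m a c).2 - 1)
  - φ ((etaH m b (c+1)).1 - (etaH m a c).1 - 1) ((etaH m b (c+1)).2 - (etaH m a c).2)
  - φ ((etaH m b c).1 - (etaH m a (c+1)).1) ((etaH m b c).2 - (etaH m a (c+1)).2 - 1)

lemma phi_congr (φ : ℤ → ℤ → ℤ) {x y x' y' : ℤ} (h : x = x') (h' : y = y') : φ x y = φ x' y' := by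
  rw [h, h']

lemma tele_lt (m a b : ℕ) (hab : a < b) (φ : ℤ → ℤ → ℤ) (n : ℕ) :
    ∑ c ∈ Finset.range n, termK m a b φ c =
      if n ≤ a then 0 else if n ≤ b then φ (-1) (-1) - φ (n - 1) (n - 1 - m) else 0 := by
  induction n with
  | zero => simp
  | succ n ih =>
    rw [Finset.sum_range_succ, ih]
    unfold termK etaH
    rcases lt_trichotomy n a with h | h | h
    · simp [show n ≤ a by omega, show n + 1 ≤ a by omega, show n ≤ b by omega,
        show n + 1 ≤ b by omega]
    · subst h
      simp [show n ≤ b by omega, show n + 1 ≤ b by omega]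
      all_goals ring_nf
    · rcases lt_trichotomy n b with h' | h' | h'
      · simp [show ¬ n ≤ a by omega, show ¬ n + 1 ≤ a by omega, show n ≤ b by omega,
          show n + 1 ≤ b by omega]
        all_goals ring_nf
      · subst h'
        simp [show ¬ n ≤ a by omega, show ¬ n + 1 ≤ a by omega]
        all_goals ring_nf
      · simp [show ¬ n ≤ a by omega, show ¬ n + 1 ≤ a by omega, show ¬ n ≤ b by omega,
          show ¬ n + 1 ≤ b by omega]
        all_goals ring_nf

lemma tele_gt (m a b : ℕ) (hab : b < a) (φ : ℤ → ℤ → ℤ) (n : ℕ) :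
    ∑ c ∈ Finset.range n, termK m a b φ c =
      if n ≤ b then 0 else if n ≤ a then φ 0 0 - φ (-n) (m - n) else 0 := by
  induction n with
  | zero => simp
  | succ n ih =>
    rw [Finset.sum_range_succ, ih]
    unfold termK etaH
    rcases lt_trichotomy n b with h | h | h
    · simp [show n ≤ a by omega, show n + 1 ≤ a by omega, show n ≤ b by omega,
        show n + 1 ≤ b by omega]
    · subst h
      simp [show n ≤ a by omega, show n + 1 ≤ a by omega]
      all_goals ring_nf
    · rcases lt_trichotomy n a with h' | h' | h'
      · simp [show ¬ n ≤ b by omega, show ¬ n + 1 ≤ b by omega, show n ≤ a by omega,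
          show n + 1 ≤ a by omega]
        all_goals ring_nf
      · subst h'
        simp [show ¬ n ≤ b by omega, show ¬ n + 1 ≤ b by omega]
        all_goals ring_nf
      · simp [show ¬ n ≤ a by omega, show ¬ n + 1 ≤ a by omega, show ¬ n ≤ b by omega,
          show ¬ n + 1 ≤ b by omega]
        all_goals ring_nf

lemma tele_eq (m a : ℕ) (φ : ℤ → ℤ → ℤ) (n : ℕ) :
    ∑ c ∈ Finset.range n, termK m a a φ c =
      if n ≤ a then 0 else φ 0 0 + φ (-1) (-1) - φ (-(a + 1)) (m - (a + 1)) - φ a (a - m) := by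
  induction n with
  | zero => simp
  | succ n ih =>
    rw [Finset.sum_range_succ, ih]
    unfold termK etaH
    rcases lt_trichotomy n a with h | h | h
    · simp [show n ≤ a by omega, show n + 1 ≤ a by omega]
    · subst h
      simp
      all_goals ring_nf
    · simp [show ¬ n ≤ a by omega, show ¬ n + 1 ≤ a by omega]
      all_goals ring_nf

/-- Indicator of an integer vector. -/
def ind (x y e f : ℤ) : ℤ := if x = e ∧ y = f then 1 else 0

def psi (x y : ℤ) : ℤ := ind x y 0 0 + ind x y 1 1 - ind x y 1 0 - ind x y 0 1

lemma ind_congr {x y e f x' y' e' f' : ℤ} (h : x - e = x' - e') (h' : y - f = y' - f') :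
    ind x y e f = ind x' y' e' f' := by
  unfold ind
  congr 1
  apply propext
  constructor <;> rintro ⟨h1, h2⟩ <;> constructor <;> omega

lemma hook_single' (m a c : ℕ) (ha : a < m) (hc : c ≤ m) (s x y e f z : ℤ)
    (hs : s = 1 ∨ s = -1)
    (hz : s * ((e - x) - (f - y)) = c + m * z) :
    ∑ c' ∈ Finset.range m, ind (x + s * (etaH m a c').1) (y + s * (etaH m a c').2) e f
      = ind (x + s * (etaH m a c).1) (y + s * (etaH m a c).2) e f := by
  have := hook_single m a c ha hc (fun w => x + s * w.1 = e ∧ y + s * w.2 = f) (by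
    rintro w ⟨h1, h2⟩
    refine ⟨z, ?_⟩
    rw [← hz]
    rcases hs with rfl | rfl <;> omega)
  simpa only [ind] using this

lemma hook_double (m a b : ℕ) (ha : a < m) (hb : b < m) (x y z : ℤ) (hz : x - y = m * z) :
    ∑ c ∈ Finset.range m, ∑ c' ∈ Finset.range m,
      psi (x + (etaH m b c').1 - (etaH m a c).1) (y + (etaH m b c').2 - (etaH m a c).2)
      = ∑ c ∈ Finset.range m, termK m a b (fun u w => ind (x + u) (y + w) 0 0) c := by
  have cont : ∀ a c : ℕ, ∃ y : ℤ, (etaH m a c).1 - (etaH m a c).2 = c + m * y := by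
    intro a c
    rcases etaH_content m a c with h | h
    · exact ⟨0, by omega⟩
    · exact ⟨-1, by omega⟩
  -- first kind
  have h1 : ∀ (e f : ℤ) (k : ℕ), k ≤ 1 → e - f = k → ∀ c ∈ Finset.range m,
      ∑ c' ∈ Finset.range m,
        ind (x + (etaH m b c').1 - (etaH m a c).1) (y + (etaH m b c').2 - (etaH m a c).2) e f
      = ind (x + (etaH m b (c+k)).1 - (etaH m a c).1) (y + (etaH m b (c+k)).2 - (etaH m a c).2) e f := by
    intro e f k hk hef c hc
    rw [Finset.mem_range] at hc
    obtain ⟨w, hw⟩ := cont a c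
    have := hook_single' m b (c + k) hb (by omega) 1 (x - (etaH m a c).1) (y - (etaH m a c).2)
      e f (w - z) (Or.inl rfl) (by rw [mul_sub]; push_cast; linarith)
    convert this using 2 with c' hc'
    · exact ind_congr (by omega) (by omega)
    · omega
    · omega
  have h2 : ∀ c' ∈ Finset.range m,
      ∑ c ∈ Finset.range m,
        ind (x + (etaH m b c').1 - (etaH m a c).1) (y + (etaH m b c').2 - (etaH m a c).2) 0 1
      = ind (x + (etaH m b c').1 - (etaH m a (c'+1)).1) (y + (etaH m b c').2 - (etaH m a (c'+1)).2) 0 1 := by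
    intro c hc
    rw [Finset.mem_range] at hc
    obtain ⟨w, hw⟩ := cont b c
    have := hook_single' m a (c + 1) ha (by omega) (-1) (x + (etaH m b c).1) (y + (etaH m b c).2)
      0 1 (w + z) (Or.inr rfl) (by rw [mul_add]; push_cast; linarith)
    convert this using 2 with c' hc'
    · exact ind_congr (by omega) (by omega)
    · omega
    · omega
  simp only [psi, termK, Finset.sum_add_distrib, Finset.sum_sub_distrib]
  rw [Finset.sum_congr rfl (h1 0 0 0 (by omega) (by simp)),
    Finset.sum_congr rfl (h1 1 1 0 (by omega) (by simp)),
    Finset.sum_congr rfl (h1 1 0 1 (by omega) (by simp)),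
    Finset.sum_comm (f := fun c c' => ind (x + (etaH m b c').1 - (etaH m a c).1) (y + (etaH m b c').2 - (etaH m a c).2) 0 1),
    Finset.sum_congr rfl h2]
  congr 1
  · congr 1
    · congr 1
      · exact Finset.sum_congr rfl fun c _ => ind_congr (by simp; omega) (by simp; omega)
      · exact Finset.sum_congr rfl fun c _ => ind_congr (by simp; omega) (by simp; omega)
    · exact Finset.sum_congr rfl fun c _ => ind_congr (by simp; omega) (by simp; omega)
  · exact Finset.sum_congr rfl fun c _ => ind_congr (by simp; omega) (by simp; omega)

lemma hook_double_ne (m a b : ℕ) (ha : a < m) (hb : b < m) (hab : a ≠ b) (x y z : ℤ)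
    (hz : x - y = m * z) :
    ∑ c ∈ Finset.range m, ∑ c' ∈ Finset.range m,
      psi (x + (etaH m b c').1 - (etaH m a c).1) (y + (etaH m b c').2 - (etaH m a c).2) = 0 := by
  rw [hook_double m a b ha hb x y z hz]
  rcases lt_or_gt_of_ne hab with h | h
  · rw [tele_lt m a b h, if_neg (by omega), if_neg (by omega)]
  · rw [tele_gt m a b h, if_neg (by omega), if_neg (by omega)]

/-- Linear independence of the two chart weights. -/
lemma chart_indep (m a : ℕ) (ha : a < m) (P Q : ℤ)
    (h1 : P * ((a : ℤ) + 1) - Q * a = 0) (h2 : P * ((a : ℤ) + 1 - m) + Q * (m - a) = 0) :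
    P = 0 ∧ Q = 0 := by
  have hm : (m : ℤ) ≠ 0 := by omega
  have hP : (m : ℤ) * P = 0 := by linear_combination ((m : ℤ) - a) * h1 + a * h2
  have hQ : (m : ℤ) * Q = 0 := by linear_combination ((m : ℤ) - a - 1) * h1 + (a + 1) * h2
  exact ⟨(mul_eq_zero.mp hP).resolve_left hm, (mul_eq_zero.mp hQ).resolve_left hm⟩

lemma hook_double_eq (m a : ℕ) (ha : a < m) (P Q : ℤ) :
    ∑ c ∈ Finset.range m, ∑ c' ∈ Finset.range m,
      psi (P * ((a : ℤ) + 1) - Q * a + (etaH m a c').1 - (etaH m a c).1)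
        (P * ((a : ℤ) + 1 - m) + Q * (m - a) + (etaH m a c').2 - (etaH m a c).2) = psi P Q := by
  rw [hook_double m a a ha ha _ _ (P - Q) (by ring), tele_eq, if_neg (by omega)]
  have key : ∀ e f x y : ℤ, x = - (e * ((a : ℤ) + 1) - f * a) →
      y = -(e * ((a : ℤ) + 1 - m) + f * (m - a)) →
      ind (P * ((a : ℤ) + 1) - Q * a + x) (P * ((a : ℤ) + 1 - m) + Q * (m - a) + y) 0 0
        = ind P Q e f := by
    rintro e f x y rfl rfl
    unfold ind
    congr 1
    apply propext
    constructor
    · rintro ⟨h1, h2⟩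
      have := chart_indep m a ha (P - e) (Q - f) (by linear_combination h1)
        (by linear_combination h2)
      omega
    · rintro ⟨rfl, rfl⟩
      constructor <;> ring
  rw [key 0 0 _ _ (by ring) (by ring), key 1 1 _ _ (by ring) (by ring),
    key 1 0 _ _ (by ring) (by ring), key 0 1 _ _ (by ring) (by ring)]
  rfl

/-- Euler characteristic of a Young diagram. -/
lemma young_euler (D : Finset (ℕ × ℕ))
    (hD : ∀ p q p' q', p' ≤ p → q' ≤ q → (p, q) ∈ D → (p', q') ∈ D) :
    ∑ x ∈ D, ∑ x' ∈ D, psi ((x'.1 : ℤ) - x.1) ((x'.2 : ℤ) - x.2)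
      = if (0, 0) ∈ D then 1 else 0 := by
  rw [Finset.sum_comm]
  have key : ∀ e f : ℕ, ∀ x' ∈ D, ∑ x ∈ D, ind ((x'.1 : ℤ) - x.1) ((x'.2 : ℤ) - x.2) e f
      = if e ≤ x'.1 ∧ f ≤ x'.2 then 1 else 0 := by
    rintro e f ⟨p, q⟩ hx
    simp only [ind]
    split_ifs with h
    · rw [Finset.sum_eq_single (p - e, q - f)]
      · rw [if_pos]
        constructor <;> simp only <;> omega
      · rintro ⟨p', q'⟩ _ hne
        rw [if_neg]
        rintro ⟨h1, h2⟩
        apply hne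
        simp only at h1 h2 h
        ext <;> simp only <;> omega
      · intro hn
        exact absurd (hD p q _ _ (by omega) (by omega) hx) hn
    · apply Finset.sum_eq_zero
      rintro ⟨p', q'⟩ _
      rw [if_neg]
      rintro ⟨h1, h2⟩
      simp only at h1 h2 h
      omega
  have k2 : ∀ x' ∈ D, ∑ x ∈ D, psi ((x'.1 : ℤ) - x.1) ((x'.2 : ℤ) - x.2)
      = if x' = (0, 0) then 1 else 0 := by
    intro x' hx
    have h00 := key 0 0 x' hx
    have h11 := key 1 1 x' hx
    have h10 := key 1 0 x' hx
    have h01 := key 0 1 x' hx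
    push_cast at h00 h11 h10 h01
    simp only [psi, Finset.sum_add_distrib, Finset.sum_sub_distrib]
    rw [h00, h11, h10, h01]
    obtain ⟨p, q⟩ := x'
    rcases p with _ | p <;> rcases q with _ | q <;> simp
  rw [Finset.sum_congr rfl k2, Finset.sum_ite_eq' D (0, 0)]

section main
variable (m : ℕ) (lam : Fin m → ℕ → ℕ) (BS : Finset (Fin m × ℕ × ℕ × ℤ × ℤ))

noncomputable def dia (a : Fin m) : Finset (ℕ × ℕ) :=
  (BS.filter fun v => v.1 = a).image fun v => (v.2.1, v.2.2.1)

lemma mem_dia (hBS : ∀ v, v ∈ BS ↔ InBoxSet m lam v) (a : Fin m) (p q : ℕ) :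
    (p, q) ∈ dia m BS a ↔ q + 1 ≤ lam a (p + 1) := by
  unfold dia
  simp only [Finset.mem_image, Finset.mem_filter, hBS, InBoxSet, Prod.mk.injEq]
  constructor
  · rintro ⟨v, ⟨⟨h1, _⟩, rfl⟩, rfl, rfl⟩
    exact h1
  · intro h
    exact ⟨(a, p, q, 0, 0), ⟨⟨h, Or.inl ⟨0, by omega, by simp⟩⟩, rfl⟩, rfl, rfl⟩

lemma sum_BS (hBS : ∀ v, v ∈ BS ↔ InBoxSet m lam v) (F : Fin m × ℕ × ℕ × ℤ × ℤ → ℤ) :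
    ∑ v ∈ BS, F v = ∑ a : Fin m, ∑ x ∈ dia m BS a, ∑ c ∈ Finset.range m,
      F (a, x.1, x.2, etaH m a c) := by
  simp only [← Finset.sum_product', Finset.sum_sigma']
  symm
  apply Finset.sum_bij (fun (i : (_ : Fin m) × ((ℕ × ℕ) × ℕ)) _ =>
    ((i.1, i.2.1.1, i.2.1.2, etaH m i.1 i.2.2) : Fin m × ℕ × ℕ × ℤ × ℤ))
  · rintro ⟨a, ⟨p, q⟩, c⟩ hi
    simp only [Finset.mem_sigma, Finset.mem_product, mem_dia m lam BS hBS, Finset.mem_range] at hi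
    rw [hBS]
    exact ⟨hi.2.1, (etaH_mem m a a.2 _).2 ⟨c, hi.2.2, rfl⟩⟩
  · rintro ⟨a, ⟨p, q⟩, c⟩ hi ⟨a', ⟨p', q'⟩, c'⟩ hi' h
    simp only [Finset.mem_sigma, Finset.mem_product, Finset.mem_range] at hi hi'
    simp only [Prod.mk.injEq] at h
    obtain ⟨rfl, rfl, rfl, h⟩ := h
    have := etaH_inj m a c c' hi.2.2 hi'.2.2 h
    subst this
    rfl
  · rintro ⟨a, p, q, h⟩ hv
    rw [hBS] at hv
    obtain ⟨c, hc, he⟩ := (etaH_mem m a a.2 _).1 hv.2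
    refine ⟨⟨a, (p, q), c⟩, ?_, ?_⟩
    · simp only [Finset.mem_sigma, Finset.mem_product, mem_dia m lam BS hBS, Finset.mem_range]
      exact ⟨Finset.mem_univ _, hv.1, hc⟩
    · simp only [he]
  · intros
    rfl

/-- Vectors of the form weight = `n • (1,1)`. -/
lemma wt_diag (v : Fin m × ℕ × ℕ × ℤ × ℤ) (hv : InBoxSet m lam v) (n : ℤ)
    (h : wt m v = (n, n)) : (v.2.1 : ℤ) = n ∧ (v.2.2.1 : ℤ) = n ∧ v.2.2.2 = (0, 0) := by
  obtain ⟨a, p, q, h0⟩ := v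
  obtain ⟨c, hc, he⟩ := (etaH_mem m a a.2 _).1 hv.2
  simp only at he
  subst he
  have hct := etaH_content m a c
  simp only [wt, Prod.mk.injEq] at h
  obtain ⟨h1, h2⟩ := h
  have hlin : (etaH m a c).1 - (etaH m a c).2 = m * ((q : ℤ) - p) := by
    linear_combination h1 - h2
  have hc0 : c = 0 := by
    have : ∃ z : ℤ, (c : ℤ) = m * z := by
      rcases hct with h | h
      · exact ⟨(q : ℤ) - p, by omega⟩
      · exact ⟨(q : ℤ) - p + 1, by rw [mul_add]; omega⟩
    obtain ⟨z, hz⟩ := this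
    have := small_mult m _ z hz (by omega) (by omega)
    omega
  subst hc0
  rw [etaH_zero] at *
  have := chart_indep m a a.2 (p - n) (q - n) (by simp only at h1; linear_combination h1)
    (by simp only at h2; linear_combination h2)
  refine ⟨by simp only; omega, by simp only; omega, rfl⟩

lemma euler_total (hlam : ∀ a, IsPartition (lam a)) (hBS : ∀ v, v ∈ BS ↔ InBoxSet m lam v) :
    ∑ v ∈ BS, ∑ v' ∈ BS, psi ((wt m v').1 - (wt m v).1) ((wt m v').2 - (wt m v).2)
      = ∑ v ∈ BS, if wt m v = (0, 0) then 1 else 0 := by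
  have hR : ∑ v ∈ BS, (if wt m v = (0, 0) then (1 : ℤ) else 0)
      = ∑ a : Fin m, if (0, 0) ∈ dia m BS a then 1 else 0 := by
    have : ∑ v ∈ BS, (if wt m v = (0, 0) then (1 : ℤ) else 0)
        = ∑ v ∈ BS, if v.2.1 = 0 ∧ v.2.2.1 = 0 ∧ v.2.2.2 = (0, 0) then (1 : ℤ) else 0 := by
      apply Finset.sum_congr rfl
      intro v hv
      congr 1
      apply propext
      constructor
      · intro h
        have := wt_diag m lam v ((hBS v).1 hv) 0 h
        exact ⟨by omega, by omega, this.2.2⟩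
      · rintro ⟨h1, h2, h3⟩
        simp [wt, h1, h2, h3]
    rw [this, sum_BS m lam BS hBS]
    apply Finset.sum_congr rfl
    intro a _
    rw [← Finset.sum_ite_eq' (dia m BS a) (0, 0) (fun _ => (1 : ℤ))]
    apply Finset.sum_congr rfl
    rintro ⟨p, q⟩ _
    simp only [Prod.mk.injEq]
    rw [Finset.sum_eq_single 0]
    · rw [etaH_zero]
      simp
    · intro c hc hne
      rw [if_neg]
      rintro ⟨_, _, h⟩
      rw [Finset.mem_range] at hc
      exact hne (etaH_inj m a c 0 hc (by omega) (by rw [h, etaH_zero]))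
    · intro h
      exact absurd (Finset.mem_range.2 (by have := a.2; omega)) h
  rw [hR, sum_BS m lam BS hBS]
  apply Finset.sum_congr rfl
  intro a _
  rw [← young_euler (dia m BS a)]
  swap
  · intro p q p' q' hp hq h
    rw [mem_dia m lam BS hBS] at h ⊢
    have := (hlam a).1 (p' + 1) (p + 1) (by omega) (by omega)
    omega
  apply Finset.sum_congr rfl
  rintro ⟨p, q⟩ _
  simp only [sum_BS m lam BS hBS]
  rw [Finset.sum_comm, Finset.sum_eq_single a]
  · rw [Finset.sum_comm]
    apply Finset.sum_congr rfl
    rintro ⟨p', q'⟩ _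
    rw [← hook_double_eq m a a.2]
    apply Finset.sum_congr rfl
    intro c _
    apply Finset.sum_congr rfl
    intro c' _
    simp only [wt]
    congr 1 <;> ring
  · intro b _ hb
    rw [Finset.sum_comm]
    apply Finset.sum_eq_zero
    rintro ⟨p', q'⟩ _
    rw [← hook_double_ne m a b a.2 b.2 (fun h => hb (Fin.ext h.symm))
      ((p' : ℤ) * ((b : ℕ) + 1) - q' * (b : ℕ) - (p * ((a : ℕ) + 1) - q * (a : ℕ)))
      ((p' : ℤ) * ((b : ℕ) + 1 - m) + q' * (m - (b : ℕ)) -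
        (p * ((a : ℕ) + 1 - m) + q * (m - (a : ℕ))))
      (p' - q' - p + q) (by ring)]
    apply Finset.sum_congr rfl
    intro c _
    apply Finset.sum_congr rfl
    intro c' _
    simp only [wt]
    congr 1 <;> ring
  · intro h
    exact absurd (Finset.mem_univ _) h

lemma color_of_diff (v v' : Fin m × ℕ × ℕ × ℤ × ℤ) (k : ℤ)
    (h : (wt m v').1 - (wt m v').2 = (wt m v).1 - (wt m v).2 + k) :
    color m v' = color m v + (k : ZMod m) := by
  unfold color
  rw [h]
  push_cast
  ring

end main

/-- The `T`-fixed term (coefficient of `x^0 y^0 q^0`) of the virtual tangent space of the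
quasimap moduli at a fixed point with quiver data `B(vec λ)` and degrees `d` equals
`N1 − N2 − N3` as in Lemma "quasimap-Tvir-fixed-term". -/
theorem quasimap_Tvir_fixed_term (m : ℕ) (hm : 1 ≤ m)
    (lam : Fin m → ℕ → ℕ) (hlam : ∀ a, IsPartition (lam a))
    (BS : Finset (Fin m × ℕ × ℕ × ℤ × ℤ))
    (hBS : ∀ v, v ∈ BS ↔ InBoxSet m lam v)
    (d : Fin m × ℕ × ℕ × ℤ × ℤ → ℤ) :
    ((∑ v ∈ BS.filter fun v => color m v = 0,
        chiAt (wt m v).1 (wt m v).2 (d v)) +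
     (∑ v ∈ BS.filter fun v => color m v = 0,
        chiAt (-(wt m v).1 - 1) (-(wt m v).2 - 1) (-d v)) +
     (∑ pr ∈ (BS ×ˢ BS).filter fun pr => color m pr.2 = color m pr.1 + 1,
        (chiAt ((wt m pr.2).1 - (wt m pr.1).1 - 1) ((wt m pr.2).2 - (wt m pr.1).2)
            (d pr.2 - d pr.1) +
         chiAt ((wt m pr.1).1 - (wt m pr.2).1) ((wt m pr.1).2 - (wt m pr.2).2 - 1)
            (d pr.1 - d pr.2))) -
     (∑ pr ∈ (BS ×ˢ BS).filter fun pr => color m pr.2 = color m pr.1,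
        (chiAt ((wt m pr.2).1 - (wt m pr.1).1) ((wt m pr.2).2 - (wt m pr.1).2)
            (d pr.2 - d pr.1) +
         chiAt ((wt m pr.1).1 - (wt m pr.2).1 - 1) ((wt m pr.1).2 - (wt m pr.2).2 - 1)
            (d pr.1 - d pr.2)))) (0, 0, 0)
    =
    (((BS ×ˢ BS).filter fun pr =>
        (((wt m pr.2).1 - (wt m pr.1).1, (wt m pr.2).2 - (wt m pr.1).2) = ((0 : ℤ), (0 : ℤ)) ∨
         ((wt m pr.2).1 - (wt m pr.1).1, (wt m pr.2).2 - (wt m pr.1).2) = ((1 : ℤ), (1 : ℤ))) ∧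
        d pr.2 < d pr.1).card : ℤ) -
    (((BS ×ˢ BS).filter fun pr =>
        (((wt m pr.2).1 - (wt m pr.1).1, (wt m pr.2).2 - (wt m pr.1).2) = ((1 : ℤ), (0 : ℤ)) ∨
         ((wt m pr.2).1 - (wt m pr.1).1, (wt m pr.2).2 - (wt m pr.1).2) = ((0 : ℤ), (1 : ℤ))) ∧
        d pr.2 < d pr.1).card : ℤ) -
    ((BS.filter fun v => wt m v = (0, 0) ∧ d v < 0).card : ℤ) := by
  have hT := euler_total m lam BS hlam hBS
  simp only [Finsupp.sub_apply, Finsupp.add_apply, Finsupp.finsetSum_apply, aux_chi,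
    Finset.sum_add_distrib]
  -- single-box terms
  have hA : ∑ v ∈ BS.filter (fun v => color m v = 0),
      (if (wt m v).1 = 0 ∧ (wt m v).2 = 0 ∧ 0 ≤ d v then (1 : ℤ) else 0)
      = (∑ v ∈ BS, if wt m v = (0, 0) then (1 : ℤ) else 0)
        - ((BS.filter fun v => wt m v = (0, 0) ∧ d v < 0).card : ℤ) := by
    rw [Finset.card_filter, Finset.sum_filter]
    push_cast
    rw [← Finset.sum_sub_distrib]
    apply Finset.sum_congr rfl
    intro v _
    by_cases h : wt m v = (0, 0)
    · have hc : color m v = 0 := by simp [color, h]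
      by_cases hd : d v < 0
      · simp [h, hc, hd]
      · simp [h, hc, hd, not_lt.1 hd]
    · have : ¬ ((wt m v).1 = 0 ∧ (wt m v).2 = 0 ∧ 0 ≤ d v) := by
        rintro ⟨h1, h2, _⟩
        exact h (Prod.ext h1 h2)
      simp [h, this]
  have hB : ∑ v ∈ BS.filter (fun v => color m v = 0),
      (if -(wt m v).1 - 1 = 0 ∧ -(wt m v).2 - 1 = 0 ∧ 0 ≤ -d v then (1 : ℤ) else 0) = 0 := by
    apply Finset.sum_eq_zero
    intro v hv
    rw [if_neg]
    rintro ⟨h1, h2, _⟩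
    have := wt_diag m lam v ((hBS v).1 (Finset.mem_filter.1 hv).1) (-1)
      (Prod.ext (by simp only; omega) (by simp only; omega))
    omega
  -- pair terms
  have hP : ∀ (e f : ℤ) (k : ZMod m), ((e - f : ℤ) : ZMod m) = k →
      ∀ Q : (Fin m × ℕ × ℕ × ℤ × ℤ) × (Fin m × ℕ × ℕ × ℤ × ℤ) → Prop, ∀ _ : DecidablePred Q,
      (∀ pr, Q pr ↔ ((wt m pr.2).1 - (wt m pr.1).1 = e ∧ (wt m pr.2).2 - (wt m pr.1).2 = f
        ∧ d pr.1 ≤ d pr.2)) →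
      ∑ pr ∈ (BS ×ˢ BS).filter (fun pr => color m pr.2 = color m pr.1 + k),
        (if Q pr then (1 : ℤ) else 0)
      = ∑ v ∈ BS, ∑ v' ∈ BS, (if (wt m v').1 - (wt m v).1 = e ∧ (wt m v').2 - (wt m v).2 = f
        ∧ d v ≤ d v' then (1 : ℤ) else 0) := by
    intro e f k hk Q _ hQ
    rw [← Finset.sum_product', Finset.sum_filter]
    apply Finset.sum_congr rfl
    intro pr _
    by_cases h : Q pr
    · have h' := (hQ pr).1 h
      rw [if_pos h', if_pos h, if_pos]
      rw [← hk]
      exact color_of_diff m _ _ _ (by omega)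
    · rw [if_neg h, if_neg (fun h' => h ((hQ pr).2 h'))]
      simp
  have hP' : ∀ (e f : ℤ) (k : ZMod m), ((f - e : ℤ) : ZMod m) = k →
      ∀ Q : (Fin m × ℕ × ℕ × ℤ × ℤ) × (Fin m × ℕ × ℕ × ℤ × ℤ) → Prop, ∀ _ : DecidablePred Q,
      (∀ pr, Q pr ↔ ((wt m pr.1).1 - (wt m pr.2).1 = e ∧ (wt m pr.1).2 - (wt m pr.2).2 = f
        ∧ d pr.2 ≤ d pr.1)) →
      ∑ pr ∈ (BS ×ˢ BS).filter (fun pr => color m pr.2 = color m pr.1 + k),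
        (if Q pr then (1 : ℤ) else 0)
      = ∑ v ∈ BS, ∑ v' ∈ BS, (if (wt m v').1 - (wt m v).1 = e ∧ (wt m v').2 - (wt m v).2 = f
        ∧ d v ≤ d v' then (1 : ℤ) else 0) := by
    intro e f k hk Q _ hQ
    rw [Finset.sum_comm, ← Finset.sum_product', Finset.sum_filter]
    apply Finset.sum_congr rfl
    intro pr _
    by_cases h : Q pr
    · have h' := (hQ pr).1 h
      rw [if_pos h', if_pos h, if_pos]
      rw [← hk]
      exact color_of_diff m _ _ _ (by omega)
    · rw [if_neg h, if_neg (fun h' => h ((hQ pr).2 h'))]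
      simp
  have e1 := hP 1 0 1 (by simp) (fun pr => (wt m pr.2).1 - (wt m pr.1).1 - 1 = 0 ∧
    (wt m pr.2).2 - (wt m pr.1).2 = 0 ∧ 0 ≤ d pr.2 - d pr.1) (fun _ => inferInstance) (by intro pr; omega)
  have e2 := hP' 0 1 1 (by simp) (fun pr => (wt m pr.1).1 - (wt m pr.2).1 = 0 ∧
    (wt m pr.1).2 - (wt m pr.2).2 - 1 = 0 ∧ 0 ≤ d pr.1 - d pr.2) (fun _ => inferInstance) (by intro pr; omega)
  have e3 := hP 0 0 0 (by simp) (fun pr => (wt m pr.2).1 - (wt m pr.1).1 = 0 ∧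
    (wt m pr.2).2 - (wt m pr.1).2 = 0 ∧ 0 ≤ d pr.2 - d pr.1) (fun _ => inferInstance) (by intro pr; omega)
  have e4 := hP' 1 1 0 (by simp) (fun pr => (wt m pr.1).1 - (wt m pr.2).1 - 1 = 0 ∧
    (wt m pr.1).2 - (wt m pr.2).2 - 1 = 0 ∧ 0 ≤ d pr.1 - d pr.2) (fun _ => inferInstance) (by intro pr; omega)
  simp only [add_zero] at e3 e4
  rw [hA, hB, e1, e2, e3, e4, ← hT, Finset.card_filter, Finset.card_filter, Finset.card_filter]
  push_cast
  rw [Finset.sum_product, Finset.sum_product]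
  rw [← sub_eq_zero]
  have : ∀ A B C D E F G X : ℤ, X + C + D - E - F - A + B = 0 →
    X - G + 0 + (C + D) - (E + F) - (A - B - G) = 0 := by intros; linarith
  apply this
  simp only [← Finset.sum_add_distrib, ← Finset.sum_sub_distrib]
  apply Finset.sum_eq_zero
  intro v _
  apply Finset.sum_eq_zero
  intro v' _
  simp only [psi, ind, Prod.mk.injEq]
  generalize (wt m v').1 - (wt m v).1 = X
  generalize (wt m v').2 - (wt m v).2 = Y
  by_cases hd : d v' < d v
  · have hd' : ¬ d v ≤ d v' := by omega
    simp only [hd, hd', and_true, and_false, if_false]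
    split_ifs <;> omega
  · have hd' : d v ≤ d v' := by omega
    simp only [hd, hd', and_true, and_false, if_false]
    split_ifs <;> omega
end

section
/- Let m ≥ 1 and let λ be a partition with empty m-core and m-quotient (q_0,…,q_{m−1}). Then in ℤ[t, t^{−1}]: Σ_{(i,j)∈λ} t^{j−i} = Σ_{a=0}^{m−1} ( Σ_{l=−(m−1−a)}^{a} t^{l} ) · ( Σ_{(i,j)∈q_a} t^{m(j−i)} ). (This expresses that the quiver data of a torus-fixed point of Hilb([ℂ²/(ℤ/m)]) and of the corresponding fixed point of Hilb(A_{m−1}) under the m-quotient bijection have equal characters after restricting to the subtorus {(t, t^{−1})} preserving the symplectic form, i.e. modulo ħ.) -/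
open scoped BigOperators

/-- The beta-set `S(λ) = {λ_i − i : i ≥ 1} ⊂ ℤ` of a partition. -/
def betaSet (f : ℕ → ℕ) : Set ℤ :=
  {s | ∃ i : ℕ, 1 ≤ i ∧ s = (f i : ℤ) - (i : ℤ)}

/-- The `r`-th slice `S_r(λ) = {(s−r)/m : s ∈ S(λ), s ≡ r (mod m)}` of the beta-set. -/
def Squot (m : ℕ) (f : ℕ → ℕ) (r : ℕ) : Set ℤ :=
  {t | ∃ s ∈ betaSet f, s = (m : ℤ) * t + (r : ℤ)}

lemma telesc_aux (G : ℤ → ℤ) (x : ℤ) (n : ℕ) :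
    ∑ j ∈ Finset.Icc 1 n, (G ((j : ℤ) + x) - G ((j : ℤ) + x - 1)) = G ((n : ℤ) + x) - G x := by
  induction n with
  | zero => simp
  | succ n ih =>
    rw [Finset.sum_Icc_succ_top (by omega), ih]
    push_cast
    rw [show (n : ℤ) + 1 + x - 1 = n + x by ring]
    ring

open Classical in
lemma cells_sum_aux (f : ℕ → ℕ) (hf : IsPartition f) (C : Finset (ℕ × ℕ))
    (hC : ∀ p, p ∈ C ↔ 1 ≤ p.1 ∧ 1 ≤ p.2 ∧ p.2 ≤ f p.1) (G : ℤ → ℤ) (N : ℕ)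
    (hN : ∀ n, N ≤ n → f n = 0) (hN1 : f 1 ≤ N) :
    ∑ p ∈ C, (G ((p.2 : ℤ) - p.1) - G ((p.2 : ℤ) - p.1 - 1)) =
      ∑ s ∈ Finset.Ico (-(N : ℤ)) N,
        ((if s ∈ betaSet f then G s else 0) - (if s < 0 then G s else 0)) := by
  have h1 : C = ((Finset.Icc 1 N).sigma (fun i => Finset.Icc 1 (f i))).map
      (Equiv.sigmaEquivProd ℕ ℕ).toEmbedding := by
    ext ⟨i, j⟩
    simp only [hC, Finset.mem_map_equiv, Finset.mem_sigma, Finset.mem_Icc,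
      Equiv.sigmaEquivProd_symm_apply]
    constructor
    · rintro ⟨h1, h2, h3⟩
      refine ⟨⟨h1, ?_⟩, h2, h3⟩
      by_contra h
      have := hN i (by omega)
      omega
    · rintro ⟨⟨h1, _⟩, h2, h3⟩
      exact ⟨h1, h2, h3⟩
  have h2 : ∑ p ∈ C, (G ((p.2 : ℤ) - p.1) - G ((p.2 : ℤ) - p.1 - 1)) =
      ∑ i ∈ Finset.Icc 1 N, (G ((f i : ℤ) - i) - G (-(i : ℤ))) := by
    rw [h1, Finset.sum_map, Finset.sum_sigma]
    refine Finset.sum_congr rfl fun i _ => ?_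
    have := telesc_aux G (-(i : ℤ)) (f i)
    simpa [sub_eq_add_neg] using this
  rw [h2, Finset.sum_sub_distrib, Finset.sum_sub_distrib, ← Finset.sum_filter,
    ← Finset.sum_filter]
  congr 1
  · refine Finset.sum_bij (fun i _ => (f i : ℤ) - i) ?_ ?_ ?_ ?_
    · intro i hi
      simp only [Finset.mem_Icc] at hi
      have := hf.1 1 i le_rfl hi.1
      simp only [Finset.mem_filter, Finset.mem_Ico]
      exact ⟨by omega, i, hi.1, rfl⟩
    · intro i hi j hj h
      simp only [Finset.mem_Icc] at hi hj
      rcases le_total i j with hij | hij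
      · have := hf.1 i j hi.1 hij
        omega
      · have := hf.1 j i hj.1 hij
        omega
    · intro s hs
      simp only [Finset.mem_filter, Finset.mem_Ico] at hs
      obtain ⟨⟨ha, hb⟩, i, hi, rfl⟩ := hs
      refine ⟨i, ?_, rfl⟩
      simp only [Finset.mem_Icc]
      refine ⟨hi, ?_⟩
      by_contra h
      have := hN i (by omega)
      omega
    · intros; rfl
  · refine Finset.sum_bij (fun i _ => -(i : ℤ)) ?_ ?_ ?_ ?_
    · intro i hi
      simp only [Finset.mem_Icc] at hi
      simp only [Finset.mem_filter, Finset.mem_Ico]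
      omega
    · intro i hi j hj h
      simpa using h
    · intro s hs
      simp only [Finset.mem_filter, Finset.mem_Ico] at hs
      refine ⟨s.natAbs, ?_, ?_⟩
      · simp only [Finset.mem_Icc]
        omega
      · omega
    · intros; rfl

lemma divmod_sum_aux (m : ℕ) (hm : 1 ≤ m) (K : ℕ) (w : ℤ → ℤ) :
    ∑ s ∈ Finset.Ico (-((m * K : ℕ) : ℤ)) ((m * K : ℕ) : ℤ), w s =
      ∑ a : Fin m, ∑ t ∈ Finset.Ico (-(K : ℤ)) K, w ((m : ℤ) * t + (a.val : ℤ)) := by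
  have hm' : (0 : ℤ) < m := by exact_mod_cast hm
  rw [← Finset.sum_product']
  symm
  refine Finset.sum_bij (fun p _ => (m : ℤ) * p.2 + (p.1.val : ℤ)) ?_ ?_ ?_ ?_
  · rintro ⟨a, t⟩ h
    simp only [Finset.mem_product, Finset.mem_univ, true_and, Finset.mem_Ico] at h ⊢
    have := a.2
    push_cast
    constructor
    · nlinarith
    · have : (a.val : ℤ) < m := by exact_mod_cast a.2
      nlinarith
  · rintro ⟨a, t⟩ _ ⟨b, u⟩ _ h
    simp only at h
    have ha : (a.val : ℤ) < m := by exact_mod_cast a.2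
    have hb : (b.val : ℤ) < m := by exact_mod_cast b.2
    have h1 : t = u := by
      have e1 : ((m : ℤ) * t + a.val) / m = t := by
        rw [Int.mul_add_ediv_left _ _ hm'.ne', Int.ediv_eq_zero_of_lt (by omega) ha, add_zero]
      have e2 : ((m : ℤ) * u + b.val) / m = u := by
        rw [Int.mul_add_ediv_left _ _ hm'.ne', Int.ediv_eq_zero_of_lt (by omega) hb, add_zero]
      rw [← e1, h, e2]
    subst h1
    have : a = b := by ext; omega
    rw [this]
  · intro s hs
    simp only [Finset.mem_Ico] at hs
    push_cast at hs
    have h1 := Int.emod_nonneg s hm'.ne'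
    have h2 := Int.emod_lt_of_pos s hm'
    have h3 := Int.mul_ediv_add_emod s m
    refine ⟨(⟨(s % m).toNat, by omega⟩, s / m), ?_, ?_⟩
    · simp only [Finset.mem_product, Finset.mem_univ, true_and, Finset.mem_Ico]
      constructor
      · rw [Int.le_ediv_iff_mul_le hm']; linarith
      · rw [Int.ediv_lt_iff_lt_mul hm']; linarith
    · simp only
      rw [Int.toNat_of_nonneg h1]
      exact h3
  · intros; rfl

lemma bound_aux (f : ℕ → ℕ) (hf : IsPartition f) :
    ∃ N, ∀ K, N ≤ K → (∀ n, K ≤ n → f n = 0) ∧ f 1 ≤ K := by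
  obtain ⟨N, hN⟩ := hf.2.1
  exact ⟨N + f 1, fun K hK => ⟨fun n hn => hN n (by omega), by omega⟩⟩

/-- If `λ` has empty `m`-core and `m`-quotient `(q_0,…,q_{m−1})`, then in `ℤ[t,t⁻¹]`
(Laurent polynomials encoded as finitely supported functions `ℤ →₀ ℤ` on exponents):
`Σ_{(i,j)∈λ} t^{j−i} = Σ_{a=0}^{m−1} (Σ_{l=−(m−1−a)}^{a} t^l)·(Σ_{(i,j)∈q_a} t^{m(j−i)})`,
i.e. the character of the fixed point of `Hilb([ℂ²/(ℤ/m)])` equals, modulo `ħ`, the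
character of the corresponding fixed point of `Hilb(A_{m−1})`. -/
theorem quotient_character_identity (m : ℕ) (hm : 1 ≤ m)
    (lam : ℕ → ℕ) (hlam : IsPartition lam)
    (q : Fin m → ℕ → ℕ) (hq : ∀ r, IsPartition (q r))
    (hquot : ∀ r : Fin m, Squot m lam r.val = betaSet (q r))
    (C : Finset (ℕ × ℕ)) (hC : ∀ p, p ∈ C ↔ 1 ≤ p.1 ∧ 1 ≤ p.2 ∧ p.2 ≤ lam p.1)
    (Cq : Fin m → Finset (ℕ × ℕ))
    (hCq : ∀ a p, p ∈ Cq a ↔ 1 ≤ p.1 ∧ 1 ≤ p.2 ∧ p.2 ≤ q a p.1) :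
    (∑ p ∈ C, Finsupp.single ((p.2 : ℤ) - (p.1 : ℤ)) (1 : ℤ)) =
      ∑ a : Fin m, ∑ l ∈ Finset.range m, ∑ p ∈ Cq a,
        Finsupp.single
          (((l : ℤ) - ((m : ℤ) - 1 - (a.val : ℤ))) + (m : ℤ) * ((p.2 : ℤ) - (p.1 : ℤ)))
          (1 : ℤ) := by
  classical
  obtain ⟨N0, hN0⟩ := bound_aux lam hlam
  choose N hN using fun a => bound_aux (q a) (hq a)
  obtain ⟨K, hK0, hK⟩ : ∃ K, N0 ≤ K ∧ ∀ a, N a ≤ K :=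
    ⟨N0 + ∑ a, N a, by omega, fun a =>
      (Finset.single_le_sum (f := N) (fun _ _ => Nat.zero_le _) (Finset.mem_univ a)).trans
        (by omega)⟩
  have hm' : (0 : ℤ) < m := by exact_mod_cast hm
  ext c
  let G : ℤ → ℤ := fun x => if c ≤ x then 1 else 0
  have hG : ∀ x : ℤ, (Finsupp.single x (1 : ℤ)) c = G x - G (x - 1) := by
    intro x
    simp only [G, Finsupp.single_apply]
    split_ifs <;> omega
  simp only [Finsupp.finsetSum_apply, hG]
  have hmK : N0 ≤ m * K := by nlinarith
  rw [cells_sum_aux lam hlam C hC G (m * K) (hN0 _ hmK).1 (hN0 _ hmK).2,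
    divmod_sum_aux m hm]
  refine Finset.sum_congr rfl fun a _ => ?_
  have ha : (a.val : ℤ) < m := by exact_mod_cast a.2
  have key := cells_sum_aux (q a) (hq a) (Cq a) (hCq a) (fun k => G ((m : ℤ) * k + a.val)) K
    (hN a K (hK a)).1 (hN a K (hK a)).2
  rw [Finset.sum_comm]
  have hin : ∀ k : ℤ, ∑ l ∈ Finset.range m, (G (((l : ℤ) - ((m : ℤ) - 1 - (a.val : ℤ))) + m * k)
      - G (((l : ℤ) - ((m : ℤ) - 1 - (a.val : ℤ))) + m * k - 1)) =
      G ((m : ℤ) * k + a.val) - G ((m : ℤ) * (k - 1) + a.val) := by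
    intro k
    have := Finset.sum_range_sub (fun l : ℕ => G ((l : ℤ) + (m * (k - 1) + a.val))) m
    convert this using 1
    · refine Finset.sum_congr rfl fun l _ => ?_
      congr 2 <;> push_cast <;> ring
    · congr 2 <;> push_cast <;> ring
  simp only [hin]
  rw [key]
  refine Finset.sum_congr rfl fun t _ => ?_
  have e1 : ((m : ℤ) * t + a.val ∈ betaSet lam) ↔ t ∈ betaSet (q a) := by
    rw [← hquot a]
    simp [Squot]
  have e2 : ((m : ℤ) * t + a.val < 0) ↔ t < 0 := by
    constructor
    · intro h
      by_contra h'
      nlinarith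
    · intro h
      nlinarith
  simp only [e1, e2]
end

section
/- Let m ≥ 1 and let λ be a partition. Then λ is uniformly colored, i.e. the number of cells (i,j) ∈ λ with (j−i) ≡ k (mod m) is the same for every residue k ∈ {0,…,m−1}, if and only if λ has empty m-core. -/
open scoped BigOperators Classical

/-- `λ` has empty `m`-core: for every residue `r` there is a partition `q_r` with
`S_r(λ) = S(q_r)`. -/
def HasEmptyMCore (m : ℕ) (f : ℕ → ℕ) : Prop :=
  ∀ r : Fin m, ∃ qr : ℕ → ℕ, IsPartition qr ∧ Squot m f r.val = betaSet qr

theorem aux_beta (f : ℕ → ℕ) (hf : IsPartition f) (K : ℕ) (hK : ∀ n, K < n → f n = 0) :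
    (∀ s, s ∈ betaSet f ↔ s ∈ (Finset.Icc 1 K).image (fun i : ℕ => (f i : ℤ) - i) ∨ s < -(K:ℤ)) ∧
    (∀ s ∈ (Finset.Icc 1 K).image (fun i : ℕ => (f i : ℤ) - i), -(K:ℤ) ≤ s) ∧
    Set.InjOn (fun i : ℕ => (f i : ℤ) - i) (Finset.Icc 1 K : Finset ℕ) := by
  refine ⟨?_, ?_, ?_⟩
  · intro s
    simp only [betaSet, Set.mem_setOf_eq, Finset.mem_image, Finset.mem_Icc]
    constructor
    · rintro ⟨i, hi, rfl⟩
      by_cases h : i ≤ K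
      · exact Or.inl ⟨i, ⟨hi, h⟩, rfl⟩
      · right
        rw [hK i (by omega)]
        push_cast
        omega
    · rintro (⟨i, ⟨h1, h2⟩, rfl⟩ | h)
      · exact ⟨i, h1, rfl⟩
      · refine ⟨s.natAbs, by omega, ?_⟩
        rw [hK _ (by omega)]
        omega
  · intro s hs
    simp only [Finset.mem_image, Finset.mem_Icc] at hs
    obtain ⟨i, ⟨h1, h2⟩, rfl⟩ := hs
    omega
  · intro i hi j hj hij
    simp only [Finset.coe_Icc, Set.mem_Icc] at hi hj
    simp only at hij
    rcases le_total i j with h | h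
    · have := hf.1 i j hi.1 h
      omega
    · have := hf.1 j i hj.1 h
      omega

theorem aux_conv (T : Set ℤ) (K : ℕ) (B : Finset ℤ) (hB : B.card = K)
    (hlow : ∀ s ∈ B, -(K:ℤ) ≤ s) (hT : ∀ s, s ∈ T ↔ s ∈ B ∨ s < -(K:ℤ)) :
    ∃ q, IsPartition q ∧ T = betaSet q := by
  let e := B.orderEmbOfFin hB
  have hmem : ∀ j, e j ∈ B := fun j => B.orderEmbOfFin_mem hB j
  have hsurj : ∀ s ∈ B, ∃ j, e j = s := by
    intro s hs
    have := B.range_orderEmbOfFin hB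
    have h2 : s ∈ Set.range (B.orderEmbOfFin hB) := by rw [this]; exact hs
    exact h2
  have hgap : ∀ d : ℕ, ∀ a : ℕ, ∀ (h : a + d < K), e ⟨a, by omega⟩ + d ≤ e ⟨a + d, h⟩ := by
    intro d
    induction d with
    | zero => intro a h; simp
    | succ d ih =>
      intro a h
      have h1 := ih a (by omega)
      have h2 : e ⟨a + d, by omega⟩ < e ⟨a + (d+1), h⟩ := by
        apply e.strictMono
        rw [Fin.lt_def]
        simp
      push_cast
      omega
  have hge : ∀ j : ℕ, ∀ (h : j < K), -(K:ℤ) + j ≤ e ⟨j, h⟩ := by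
    intro j h
    have h1 := hgap j 0 (by omega)
    have h2 := hlow _ (hmem ⟨0, by omega⟩)
    simp only [zero_add] at h1
    omega
  let q : ℕ → ℕ := fun i => if h : 1 ≤ i ∧ i ≤ K then (e ⟨K - i, by omega⟩ + i).toNat else 0
  have hq0 : ∀ n, K < n → q n = 0 := by
    intro n hn
    simp only [q]
    rw [dif_neg (by omega)]
  have hq1 : ∀ i, ∀ h : 1 ≤ i ∧ i ≤ K, (q i : ℤ) = e ⟨K - i, by omega⟩ + i := by
    intro i h
    simp only [q]
    rw [dif_pos h]
    have := hge (K - i) (by omega)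
    omega
  have hpart : IsPartition q := by
    refine ⟨?_, ⟨K+1, fun n hn => hq0 n (by omega)⟩, by simp [q]⟩
    intro i j hi hij
    by_cases hj : j ≤ K
    · have h1 := hq1 i ⟨hi, by omega⟩
      have h2 := hq1 j ⟨by omega, hj⟩
      have h3 := hgap (j - i) (K - j) (by omega)
      have h4 : K - j + (j - i) = K - i := by omega
      simp only [h4] at h3
      omega
    · rw [hq0 j (by omega)]; omega
  refine ⟨q, hpart, ?_⟩
  ext s
  rw [hT, (aux_beta q hpart K hq0).1 s]
  refine or_congr_left ?_
  simp only [Finset.mem_image, Finset.mem_Icc]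
  constructor
  · intro hs
    obtain ⟨j, rfl⟩ := hsurj s hs
    refine ⟨K - j, ⟨by omega, by omega⟩, ?_⟩
    rw [hq1 _ ⟨by omega, by omega⟩]
    have : K - (K - (j:ℕ)) = j := by omega
    simp [this]
  · rintro ⟨i, hi, rfl⟩
    rw [hq1 i hi]
    simp [hmem]

theorem aux_uniq (T : Set ℤ) (M : ℕ) (B : Finset ℤ)
    (hlow : ∀ s ∈ B, -(M:ℤ) ≤ s) (hT : ∀ s, s ∈ T ↔ s ∈ B ∨ s < -(M:ℤ)) :
    (∃ q, IsPartition q ∧ T = betaSet q) ↔ B.card = M := by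
  refine ⟨?_, fun h => aux_conv T M B h hlow hT⟩
  rintro ⟨q, hq, rfl⟩
  obtain ⟨N, hN⟩ := hq.2.1
  obtain ⟨h1, h2, h3⟩ := aux_beta q hq (N + M) (fun n hn => hN n (by omega))
  set B' := (Finset.Icc 1 (N+M)).image (fun i : ℕ => (q i : ℤ) - i) with hB'
  have hc : B'.card = N + M := by
    rw [hB', Finset.card_image_of_injOn h3]; simp
  have hd : Disjoint B (Finset.Ico (-((N + M : ℕ):ℤ)) (-(M:ℤ))) := by
    rw [Finset.disjoint_left]
    intro s hs hs'
    have := hlow s hs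
    simp only [Finset.mem_Ico] at hs'
    omega
  have he : B' = B ∪ Finset.Ico (-((N + M : ℕ):ℤ)) (-(M:ℤ)) := by
    ext s
    have e1 := (h1 s).symm.trans (hT s)
    have e2 := h2 s
    have e3 := hlow s
    simp only [Finset.mem_union, Finset.mem_Ico]
    constructor
    · intro hs
      have := e2 hs
      rcases e1.1 (Or.inl hs) with h | h
      · exact Or.inl h
      · right; omega
    · rintro (hs | hs)
      · have := e3 hs
        rcases e1.2 (Or.inl hs) with h | h
        · exact h
        · push_cast at h; omega
      · rcases e1.2 (Or.inr hs.2) with h | h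
        · exact h
        · omega
  rw [he, Finset.card_union_of_disjoint hd, Int.card_Ico] at hc
  push_cast at hc
  omega

theorem aux_slice (m : ℕ) (hm : 1 ≤ m) (r : ℕ) (B B' : Finset ℤ)
    (h : ∀ t, t ∈ B' ↔ (m:ℤ) * t + r ∈ B) :
    (B.filter (fun s : ℤ => (s : ZMod m) = (r : ZMod m))).card = B'.card := by
  symm
  apply Finset.card_bij (fun t _ => (m:ℤ) * t + r)
  · intro t ht
    simp [← h, ht]
  · intro a _ b _ hab
    have : m ≠ 0 := by omega
    simpa [this] using hab
  · intro s hs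
    simp only [Finset.mem_filter] at hs
    have h2 : ((s : ℤ) : ZMod m) = ((r:ℤ) : ZMod m) := by rw [hs.2]; simp
    rw [ZMod.intCast_eq_intCast_iff_dvd_sub] at h2
    obtain ⟨t, ht⟩ := h2
    have e : (m:ℤ) * (-t) + r = s := by rw [mul_neg, ← ht]; ring
    exact ⟨-t, by rw [h, e]; exact hs.1, e⟩

theorem aux_row (m : ℕ) (k : ZMod m) (i n : ℕ) :
    (∑ j ∈ Finset.Icc 1 n, if ((((j:ℤ) - (i:ℤ) : ℤ)) : ZMod m) = k then 1 else 0)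
      + (if (((-(i:ℤ) : ℤ)) : ZMod m) = k then 1 else 0) =
    (∑ j ∈ Finset.Icc 1 n, if ((((j:ℤ) - (i:ℤ) : ℤ)) : ZMod m) = k + 1 then 1 else 0)
      + (if ((((n:ℤ) - (i:ℤ) : ℤ)) : ZMod m) = k then 1 else 0) := by
  induction n with
  | zero => simp
  | succ n ih =>
    rw [Finset.sum_Icc_succ_top (by omega), Finset.sum_Icc_succ_top (by omega)]
    have : ((((n+1:ℕ):ℤ) - (i:ℤ) : ℤ) : ZMod m) = k + 1 ↔ ((((n:ℤ) - (i:ℤ) : ℤ)) : ZMod m) = k := by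
      push_cast
      constructor
      · intro h; linear_combination h
      · intro h; linear_combination h
    simp only [this]
    omega

/-- A partition is uniformly colored — the number of cells `(i,j) ∈ λ` with
`(j−i) ≡ k (mod m)` is the same for every residue `k` — if and only if it has empty
`m`-core. -/
theorem uniformly_colored_iff_empty_m_core (m : ℕ) (hm : 1 ≤ m)
    (lam : ℕ → ℕ) (hlam : IsPartition lam)
    (C : Finset (ℕ × ℕ)) (hC : ∀ p, p ∈ C ↔ 1 ≤ p.1 ∧ 1 ≤ p.2 ∧ p.2 ≤ lam p.1) :
    (∀ k k' : ZMod m,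
      (C.filter fun p => ((((p.2 : ℤ) - (p.1 : ℤ)) : ℤ) : ZMod m) = k).card =
      (C.filter fun p => ((((p.2 : ℤ) - (p.1 : ℤ)) : ℤ) : ZMod m) = k').card) ↔
    HasEmptyMCore m lam := by
  haveI : NeZero m := ⟨by omega⟩
  obtain ⟨N0, hN0⟩ := hlam.2.1
  obtain ⟨M, hM⟩ : ∃ M, M = N0 := ⟨_, rfl⟩
  have hNM : M ≤ m * M := Nat.le_mul_of_pos_left _ hm
  have hz : ∀ n, m * M < n → lam n = 0 := fun n hn => hN0 n (by omega)
  obtain ⟨h1, h2, h3⟩ := aux_beta lam hlam (m * M) hz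
  set B := (Finset.Icc 1 (m * M)).image (fun i : ℕ => (lam i : ℤ) - i) with hB
  have hmz : (0:ℤ) < m := by omega
  -- the color recursion
  have hcol : ∀ k : ZMod m,
      (C.filter fun p => ((((p.2 : ℤ) - (p.1 : ℤ)) : ℤ) : ZMod m) = k).card
        + ((Finset.Icc 1 (m * M)).filter (fun i : ℕ => ((-(i:ℤ) : ℤ) : ZMod m) = k)).card =
      (C.filter fun p => ((((p.2 : ℤ) - (p.1 : ℤ)) : ℤ) : ZMod m) = k + 1).card
        + (B.filter (fun s : ℤ => (s : ZMod m) = k)).card := by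
    intro k
    have hs : ∀ p : ℕ × ℕ, p ∈ C ↔ p.1 ∈ Finset.Icc 1 (m * M) ∧ p.2 ∈ Finset.Icc 1 (lam p.1) := by
      intro p
      rw [hC, Finset.mem_Icc, Finset.mem_Icc]
      constructor
      · rintro ⟨a, b, c⟩
        refine ⟨⟨a, ?_⟩, b, c⟩
        by_contra hh
        rw [hz _ (by omega)] at c
        omega
      · rintro ⟨⟨a, _⟩, b, c⟩
        exact ⟨a, b, c⟩
    simp only [Finset.card_filter]
    rw [Finset.sum_finset_product C (Finset.Icc 1 (m * M)) (fun i => Finset.Icc 1 (lam i)) hs,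
      Finset.sum_finset_product C (Finset.Icc 1 (m * M)) (fun i => Finset.Icc 1 (lam i)) hs,
      hB, Finset.sum_image h3, ← Finset.sum_add_distrib, ← Finset.sum_add_distrib]
    exact Finset.sum_congr rfl fun i _ => aux_row m k i (lam i)
  have hbase : ∀ r : ℕ, r < m → ((Finset.Icc 1 (m * M)).filter
      (fun i : ℕ => ((-(i:ℤ) : ℤ) : ZMod m) = (r : ZMod m))).card = M := by
    intro r hr
    have := aux_slice m hm r (Finset.Ico (-((m * M : ℕ) : ℤ)) 0) (Finset.Ico (-(M:ℤ)) 0) (by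
      intro t
      simp only [Finset.mem_Ico]
      push_cast
      constructor
      · rintro ⟨a, b⟩
        constructor <;> nlinarith
      · rintro ⟨a, b⟩
        constructor <;> by_contra hh
        · have : t + 1 ≤ -M := by omega
          nlinarith
        · nlinarith)
    rw [Int.card_Ico] at this
    have e : (0 - -(M:ℤ)).toNat = M := by omega
    rw [e] at this
    refine Eq.trans ?_ this
    apply Finset.card_bij (fun (i : ℕ) _ => -(i:ℤ))
    · intro i hi
      simp only [Finset.mem_filter, Finset.mem_Icc, Finset.mem_Ico] at hi ⊢
      exact ⟨⟨by omega, by omega⟩, hi.2⟩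
    · intro a _ b _ hab
      omega
    · intro s hs
      simp only [Finset.mem_filter, Finset.mem_Ico] at hs
      have e : -((s.natAbs : ℕ) : ℤ) = s := by omega
      refine ⟨s.natAbs, ?_, e⟩
      simp only [Finset.mem_filter, Finset.mem_Icc]
      exact ⟨⟨by omega, by omega⟩, by rw [e]; exact hs.2⟩
  have hcore : ∀ r : ℕ, r < m → ((∃ qr : ℕ → ℕ, IsPartition qr ∧ Squot m lam r = betaSet qr) ↔
      (B.filter (fun s : ℤ => (s : ZMod m) = (r : ZMod m))).card = M) := by
    intro r hr
    have hinj : Set.InjOn (fun t : ℤ => (m:ℤ) * t + r) ((fun t : ℤ => (m:ℤ) * t + r) ⁻¹' (B : Set ℤ)) := by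
      intro a _ b _ hab
      have : m ≠ 0 := by omega
      simpa [this] using hab
    have hmem : ∀ t, t ∈ B.preimage _ hinj ↔ (m:ℤ) * t + r ∈ B := by
      intro t; simp only [Finset.mem_preimage]
    rw [aux_slice m hm r B (B.preimage _ hinj) hmem]
    have key : ∀ t : ℤ, (m:ℤ) * t + r < -((m * M : ℕ):ℤ) ↔ t < -(M:ℤ) := by
      intro t
      push_cast
      constructor
      · intro h
        by_contra hh
        nlinarith
      · intro h
        have : t + 1 ≤ -M := by omega
        nlinarith
    apply aux_uniq
    · intro t ht
      have := h2 _ ((hmem t).1 ht)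
      have := (key t).not
      omega
    · intro t
      rw [hmem, ← key t, ← h1]
      simp [Squot]
  have hval : ∀ k : ZMod m, ((k.val : ℕ) : ZMod m) = k := fun k => ZMod.natCast_zmod_val k
  constructor
  · intro h r
    rw [hcore r.val r.isLt]
    have a := hcol (r.val : ZMod m)
    rw [hbase r.val r.isLt, h _ ((r.val : ZMod m) + 1)] at a
    omega
  · intro h
    have hstep : ∀ k : ZMod m,
        (C.filter fun p => ((((p.2 : ℤ) - (p.1 : ℤ)) : ℤ) : ZMod m) = k + 1).card =
        (C.filter fun p => ((((p.2 : ℤ) - (p.1 : ℤ)) : ℤ) : ZMod m) = k).card := by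
      intro k
      have a := hcol k
      have b := hbase k.val (ZMod.val_lt k)
      have c := (hcore k.val (ZMod.val_lt k)).1 (h ⟨k.val, ZMod.val_lt k⟩)
      rw [hval] at b c
      omega
    have hall : ∀ n : ℕ,
        (C.filter fun p => ((((p.2 : ℤ) - (p.1 : ℤ)) : ℤ) : ZMod m) = (n : ZMod m)).card =
        (C.filter fun p => ((((p.2 : ℤ) - (p.1 : ℤ)) : ℤ) : ZMod m) = ((0 : ℕ) : ZMod m)).card := by
      intro n
      induction n with
      | zero => rfl
      | succ n ih =>
        rw [← ih, Nat.cast_succ, hstep]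
    intro k k'
    have a := hall k.val
    have b := hall k'.val
    rw [hval] at a b
    rw [a, b]
end

section
/- Let λ and μ be partitions and set Q_ν(x,y) := Σ_{(i,j)∈ν} x^{j−1} y^{i−1} and Q̄_ν(x,y) := Q_ν(x^{−1}, y^{−1}). Then in ℤ[x^{±1}, y^{±1}]: Q_μ + (xy)^{−1} Q̄_λ − (xy)^{−1}(1−x)(1−y) Q̄_λ Q_μ = Σ_{(i,j)∈λ} x^{−a_λ(i,j)−1} y^{ℓ_μ(i,j)} + Σ_{(i,j)∈μ} x^{a_μ(i,j)} y^{−ℓ_λ(i,j)−1}. (This is the arm-leg expansion of the virtual character T_{λ,μ} = χ(O_{ℂ²}) − χ(I_λ, I_μ) governing tangent spaces of instanton moduli on ℂ² at torus-fixed points.) -/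
open scoped BigOperators

/-- The transpose partition: `(λ^t)_j = #{i ≥ 1 : λ_i ≥ j}`. -/
noncomputable def conj (f : ℕ → ℕ) (j : ℕ) : ℕ :=
  Set.ncard {i : ℕ | 1 ≤ i ∧ j ≤ f i}

/-- The monomial `x^a y^b` in the Laurent polynomial ring
`ℤ[x^{±1}, y^{±1}] = AddMonoidAlgebra ℤ (ℤ × ℤ)`. -/
noncomputable def X2 (a b : ℤ) : AddMonoidAlgebra ℤ (ℤ × ℤ) :=
  AddMonoidAlgebra.single (a, b) 1

theorem X2_mul (a b c d : ℤ) : X2 a b * X2 c d = X2 (a + c) (b + d) := by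
  simp [X2, AddMonoidAlgebra.single_mul_single]

theorem X2_zero : X2 0 0 = 1 := rfl

theorem X2_tele_y (a e : ℤ) (c : ℕ) :
    X2 a (e + c) = X2 a e - (1 - X2 0 1) * ∑ k ∈ Finset.range c, X2 a (e + k) := by
  induction c with
  | zero => simp
  | succ n ih =>
    rw [Finset.sum_range_succ, mul_add, ← sub_sub, ← ih, sub_mul, one_mul, X2_mul]
    rw [sub_sub_cancel]
    congr 1 <;> push_cast <;> ring

theorem X2_tele_y' (a e : ℤ) (c : ℕ) :
    X2 a (e - c) = X2 a e + (1 - X2 0 1) * ∑ k ∈ Finset.range c, X2 a (e - k - 1) := by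
  induction c with
  | zero => simp
  | succ n ih =>
    rw [Finset.sum_range_succ, mul_add, ← add_assoc, ← ih, sub_mul, one_mul, X2_mul]
    have h1 : X2 (0 + a) (1 + (e - n - 1)) = X2 a (e - n) := by congr 1 <;> ring
    have h2 : X2 a (e - (n + 1 : ℕ)) = X2 a (e - n - 1) := by
      congr 1; push_cast; ring
    rw [h1, h2]; ring

theorem X2_tele_x (e : ℤ) (c : ℕ) :
    (1 - X2 1 0) * ∑ k ∈ Finset.range c, X2 k e = X2 0 e - X2 c e := by
  induction c with
  | zero => simp
  | succ n ih =>
    rw [Finset.sum_range_succ, mul_add, ih, sub_mul, one_mul, X2_mul]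
    have h1 : X2 (1 + n) (0 + e) = X2 (n + 1 : ℕ) e := by congr 1 <;> push_cast <;> ring
    rw [h1]; ring

theorem X2_tele_x' (e : ℤ) (c : ℕ) :
    (1 - X2 1 0) * ∑ k ∈ Finset.range c, X2 (-k - 1) e = X2 (-c) e - X2 0 e := by
  induction c with
  | zero => simp
  | succ n ih =>
    rw [Finset.sum_range_succ, mul_add, ih, sub_mul, one_mul, X2_mul]
    have h1 : X2 (1 + (-n - 1)) (0 + e) = X2 (-n) e := by congr 1 <;> ring
    have h2 : X2 (-(n + 1 : ℕ)) e = X2 (-n - 1) e := by congr 1; push_cast; ring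
    rw [h1, h2]; ring

theorem X2_refl (a : ℕ) (t e : ℤ) :
    ∑ j ∈ Finset.range a, X2 (t + j - a) e = ∑ j ∈ Finset.range a, X2 (t - j - 1) e := by
  rw [← Finset.sum_range_reflect]
  refine Finset.sum_congr rfl fun j hj => ?_
  rw [Finset.mem_range] at hj
  congr 1
  omega

theorem sum_ite_le {a b : ℕ} (h : a ≤ b) (f : ℕ → AddMonoidAlgebra ℤ (ℤ × ℤ)) :
    ∑ j ∈ Finset.range b, (if j < a then f j else 0) = ∑ j ∈ Finset.range a, f j := by
  rw [← Finset.sum_filter]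
  refine Finset.sum_congr ?_ fun _ _ => rfl
  ext j; simp; omega

theorem sum_ite_ge {a b : ℕ} (h : a ≤ b) (f : ℕ → AddMonoidAlgebra ℤ (ℤ × ℤ)) :
    ∑ j ∈ Finset.range a, (if j < b then f j else 0) = ∑ j ∈ Finset.range a, f j := by
  refine Finset.sum_congr rfl fun j hj => ?_
  rw [Finset.mem_range] at hj
  rw [if_pos (by omega)]

theorem X2_key (a b : ℕ) (u v : ℤ) :
    (1 - X2 1 0) * (∑ j ∈ Finset.range a, X2 (-j - 1) u) * (∑ j ∈ Finset.range b, X2 j v) =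
    ∑ j ∈ Finset.range a, (if j < b then X2 (j - a) (u + v) else 0) -
    ∑ j ∈ Finset.range b, (if j < a then X2 (b - j - 1) (u + v) else 0) := by
  rcases le_total a b with h | h
  · rw [sum_ite_ge h, sum_ite_le h, mul_right_comm, X2_tele_x, sub_mul, Finset.mul_sum,
      Finset.mul_sum]
    have := X2_refl a 0 (u + v)
    simp only [zero_add, zero_sub] at this
    rw [this]
    congr 1 <;> refine Finset.sum_congr rfl fun j _ => ?_ <;> rw [X2_mul] <;> congr 1 <;> ring
  · rw [sum_ite_ge h, sum_ite_le h, X2_tele_x', sub_mul, Finset.mul_sum, Finset.mul_sum]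
    have := X2_refl b b (u + v)
    rw [← this]
    congr 1 <;> refine Finset.sum_congr rfl fun j _ => ?_ <;> rw [X2_mul] <;> congr 1 <;> ring

theorem lt_conj_iff {f : ℕ → ℕ} (hf : IsPartition f) (i j : ℕ) :
    i < conj f (j + 1) ↔ j < f (i + 1) := by
  obtain ⟨h1, ⟨N, hN⟩, h0⟩ := hf
  have hex : ∃ n, f (n + 1) < j + 1 := ⟨N, by rw [hN _ (by omega)]; omega⟩
  classical
  have key : ∀ n, n < Nat.find hex ↔ j < f (n + 1) := by
    intro n
    constructor
    · intro h
      have := Nat.find_min hex h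
      omega
    · intro h
      by_contra hc
      have h2 := Nat.find_spec hex
      have := h1 (Nat.find hex + 1) (n + 1) (by omega) (by omega)
      omega
  have hs : {i : ℕ | 1 ≤ i ∧ j + 1 ≤ f i} = (Finset.Icc 1 (Nat.find hex) : Finset ℕ) := by
    ext n
    rcases n with _ | n
    · simp
    · have := key n
      simp only [Set.mem_ofPred_eq, Finset.coe_Icc, Set.mem_Icc]
      omega
  rw [conj, hs, Set.ncard_coe_finset, Nat.card_Icc, Nat.add_sub_cancel]
  exact key i

theorem sum_cells {f : ℕ → ℕ} {N : ℕ} (hN : ∀ n, N ≤ n → f n = 0) (C : Finset (ℕ × ℕ))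
    (hC : ∀ p, p ∈ C ↔ 1 ≤ p.1 ∧ 1 ≤ p.2 ∧ p.2 ≤ f p.1)
    (g : ℕ → ℕ → AddMonoidAlgebra ℤ (ℤ × ℤ)) :
    ∑ p ∈ C, g p.1 p.2 =
      ∑ i ∈ Finset.range N, ∑ j ∈ Finset.range (f (i + 1)), g (i + 1) (j + 1) := by
  rw [Finset.sum_sigma']
  symm
  refine Finset.sum_bij (fun p _ => (p.1 + 1, p.2 + 1)) ?_ ?_ ?_ ?_
  · rintro ⟨i, j⟩ h
    simp only [Finset.mem_sigma, Finset.mem_range] at h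
    rw [hC]
    simp only
    omega
  · rintro ⟨i, j⟩ _ ⟨i', j'⟩ _ h
    simp only [Prod.mk.injEq, add_left_inj] at h
    obtain ⟨rfl, rfl⟩ := h
    rfl
  · rintro ⟨i, j⟩ h
    rw [hC] at h
    obtain ⟨h1, h2, h3⟩ := h
    simp only at h1 h2 h3
    refine ⟨⟨i - 1, j - 1⟩, ?_, ?_⟩
    · simp only [Finset.mem_sigma, Finset.mem_range]
      rw [Nat.sub_add_cancel h1]
      refine ⟨?_, by omega⟩
      by_contra hc
      have := hN i (by omega)
      omega
    · simp only [Nat.sub_add_cancel h1, Nat.sub_add_cancel h2]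
  · intros; rfl

theorem sum_conj {f : ℕ → ℕ} (hf : IsPartition f) {N : ℕ} (hN : ∀ n, N ≤ n → f n = 0) (j : ℕ)
    (g : ℕ → AddMonoidAlgebra ℤ (ℤ × ℤ)) :
    ∑ k ∈ Finset.range (conj f (j + 1)), g k =
      ∑ k ∈ Finset.range N, if j < f (k + 1) then g k else 0 := by
  have hle : conj f (j + 1) ≤ N := by
    by_contra hc
    have := (lt_conj_iff hf N j).1 (by omega)
    rw [hN _ (by omega)] at this
    omega
  rw [← sum_ite_le hle]
  refine Finset.sum_congr rfl fun k _ => ?_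
  simp only [lt_conj_iff hf]

/-- Arm-leg expansion of the virtual character `T_{λ,μ} = χ(O_{ℂ²}) − χ(I_λ, I_μ)`:
with `Q_ν = Σ_{(i,j)∈ν} x^{j−1} y^{i−1}` and `Q̄_ν = Q_ν(x⁻¹, y⁻¹)`, one has
`Q_μ + (xy)⁻¹ Q̄_λ − (xy)⁻¹(1−x)(1−y) Q̄_λ Q_μ
  = Σ_{(i,j)∈λ} x^{−a_λ(i,j)−1} y^{ℓ_μ(i,j)} + Σ_{(i,j)∈μ} x^{a_μ(i,j)} y^{−ℓ_λ(i,j)−1}`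
in `ℤ[x^{±1}, y^{±1}]`. -/
theorem arm_leg_expansion (lam mu : ℕ → ℕ) (hlam : IsPartition lam) (hmu : IsPartition mu)
    (Cl Cm : Finset (ℕ × ℕ))
    (hCl : ∀ p, p ∈ Cl ↔ 1 ≤ p.1 ∧ 1 ≤ p.2 ∧ p.2 ≤ lam p.1)
    (hCm : ∀ p, p ∈ Cm ↔ 1 ≤ p.1 ∧ 1 ≤ p.2 ∧ p.2 ≤ mu p.1) :
    (∑ p ∈ Cm, X2 ((p.2 : ℤ) - 1) ((p.1 : ℤ) - 1)) +
      X2 (-1) (-1) * (∑ p ∈ Cl, X2 (1 - (p.2 : ℤ)) (1 - (p.1 : ℤ))) -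
      X2 (-1) (-1) * (1 - X2 1 0) * (1 - X2 0 1) *
        (∑ p ∈ Cl, X2 (1 - (p.2 : ℤ)) (1 - (p.1 : ℤ))) *
        (∑ p ∈ Cm, X2 ((p.2 : ℤ) - 1) ((p.1 : ℤ) - 1)) =
    (∑ p ∈ Cl, X2 (-((lam p.1 : ℤ) - (p.2 : ℤ)) - 1) ((conj mu p.2 : ℤ) - (p.1 : ℤ))) +
    (∑ p ∈ Cm, X2 ((mu p.1 : ℤ) - (p.2 : ℤ)) (-((conj lam p.2 : ℤ) - (p.1 : ℤ)) - 1)) := by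
  obtain ⟨N1, hN1⟩ := hlam.2.1
  obtain ⟨N2, hN2⟩ := hmu.2.1
  obtain ⟨N, hNl, hNm⟩ : ∃ N, (∀ n, N ≤ n → lam n = 0) ∧ (∀ n, N ≤ n → mu n = 0) :=
    ⟨max N1 N2, fun n hn => hN1 n (le_trans (le_max_left _ _) hn),
      fun n hn => hN2 n (le_trans (le_max_right _ _) hn)⟩
  have eQm := sum_cells hNm Cm hCm (fun i j => X2 ((j : ℤ) - 1) ((i : ℤ) - 1))
  have eQl : X2 (-1) (-1) * (∑ p ∈ Cl, X2 (1 - (p.2 : ℤ)) (1 - (p.1 : ℤ))) =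
      ∑ i ∈ Finset.range N, ∑ j ∈ Finset.range (lam (i + 1)), X2 (-j - 1) (-i - 1) := by
    rw [Finset.mul_sum]
    simp only [X2_mul]
    rw [sum_cells hNl Cl hCl (fun i j => X2 (-1 + (1 - (j : ℤ))) (-1 + (1 - (i : ℤ))))]
    refine Finset.sum_congr rfl fun i _ => Finset.sum_congr rfl fun j _ => ?_
    congr 1 <;> push_cast <;> ring
  have eQm' : (∑ p ∈ Cm, X2 ((p.2 : ℤ) - 1) ((p.1 : ℤ) - 1)) =
      ∑ k ∈ Finset.range N, ∑ j ∈ Finset.range (mu (k + 1)), X2 j k := by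
    rw [eQm]
    refine Finset.sum_congr rfl fun i _ => Finset.sum_congr rfl fun j _ => ?_
    congr 1 <;> push_cast <;> ring
  have e1 : (∑ p ∈ Cl, X2 (-((lam p.1 : ℤ) - (p.2 : ℤ)) - 1) ((conj mu p.2 : ℤ) - (p.1 : ℤ))) =
      (∑ i ∈ Finset.range N, ∑ j ∈ Finset.range (lam (i + 1)), X2 (-j - 1) (-i - 1)) -
      (1 - X2 0 1) * ∑ i ∈ Finset.range N, ∑ k ∈ Finset.range N,
        ∑ j ∈ Finset.range (lam (i + 1)),
          if j < mu (k + 1) then X2 (j - lam (i + 1)) (-i - 1 + k) else 0 := by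
    rw [sum_cells hNl Cl hCl
      (fun i j => X2 (-((lam i : ℤ) - (j : ℤ)) - 1) ((conj mu j : ℤ) - (i : ℤ))),
      Finset.mul_sum, ← Finset.sum_sub_distrib]
    refine Finset.sum_congr rfl fun i _ => ?_
    have := X2_refl (lam (i + 1)) 0 (-i - 1)
    simp only [zero_add, zero_sub] at this
    rw [Finset.sum_comm, ← this, Finset.mul_sum, ← Finset.sum_sub_distrib]
    refine Finset.sum_congr rfl fun j _ => ?_
    rw [← sum_conj hmu hNm j (fun k => X2 (j - lam (i + 1)) (-i - 1 + k)), ← X2_tele_y]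
    congr 1 <;> push_cast <;> ring
  have e2 : (∑ p ∈ Cm, X2 ((mu p.1 : ℤ) - (p.2 : ℤ)) (-((conj lam p.2 : ℤ) - (p.1 : ℤ)) - 1)) =
      (∑ k ∈ Finset.range N, ∑ j ∈ Finset.range (mu (k + 1)), X2 j k) +
      (1 - X2 0 1) * ∑ k ∈ Finset.range N, ∑ i ∈ Finset.range N,
        ∑ j ∈ Finset.range (mu (k + 1)),
          if j < lam (i + 1) then X2 (mu (k + 1) - j - 1) (-i - 1 + k) else 0 := by
    rw [sum_cells hNm Cm hCm
      (fun i j => X2 ((mu i : ℤ) - (j : ℤ)) (-((conj lam j : ℤ) - (i : ℤ)) - 1)),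
      Finset.mul_sum, ← Finset.sum_add_distrib]
    refine Finset.sum_congr rfl fun k _ => ?_
    have := X2_refl (mu (k + 1)) (mu (k + 1)) k
    simp only [add_sub_cancel_left] at this
    rw [Finset.sum_comm, this, Finset.mul_sum, ← Finset.sum_add_distrib]
    refine Finset.sum_congr rfl fun j _ => ?_
    rw [← sum_conj hlam hNl j (fun i => X2 (mu (k + 1) - j - 1) (-i - 1 + k))]
    have h3 := X2_tele_y' (mu (k + 1) - j - 1) k (conj lam (j + 1))
    have h4 : ∀ i : ℕ, (k : ℤ) - i - 1 = -i - 1 + k := fun i => by ring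
    simp only [h4] at h3
    rw [← h3]
    congr 1 <;> push_cast <;> ring
  have e3 : X2 (-1) (-1) * (1 - X2 1 0) * (1 - X2 0 1) *
        (∑ p ∈ Cl, X2 (1 - (p.2 : ℤ)) (1 - (p.1 : ℤ))) *
        (∑ p ∈ Cm, X2 ((p.2 : ℤ) - 1) ((p.1 : ℤ) - 1)) =
      (1 - X2 0 1) * ((1 - X2 1 0) *
        (X2 (-1) (-1) * (∑ p ∈ Cl, X2 (1 - (p.2 : ℤ)) (1 - (p.1 : ℤ)))) *
        (∑ p ∈ Cm, X2 ((p.2 : ℤ) - 1) ((p.1 : ℤ) - 1))) := by ring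
  have e4 : (1 - X2 1 0) *
      (∑ i ∈ Finset.range N, ∑ j ∈ Finset.range (lam (i + 1)), X2 (-j - 1) (-i - 1)) *
      (∑ k ∈ Finset.range N, ∑ j ∈ Finset.range (mu (k + 1)), X2 j k) =
      (∑ i ∈ Finset.range N, ∑ k ∈ Finset.range N,
        ∑ j ∈ Finset.range (lam (i + 1)),
          if j < mu (k + 1) then X2 (j - lam (i + 1)) (-i - 1 + k) else 0) -
      ∑ k ∈ Finset.range N, ∑ i ∈ Finset.range N,
        ∑ j ∈ Finset.range (mu (k + 1)),
          if j < lam (i + 1) then X2 (mu (k + 1) - j - 1) (-i - 1 + k) else 0 := by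
    rw [Finset.sum_comm (s := Finset.range N) (t := Finset.range N)
      (f := fun k i => ∑ j ∈ Finset.range (mu (k + 1)),
          if j < lam (i + 1) then X2 (mu (k + 1) - j - 1) (-i - 1 + k) else 0),
      mul_assoc, Finset.sum_mul_sum, Finset.mul_sum, ← Finset.sum_sub_distrib]
    refine Finset.sum_congr rfl fun i _ => ?_
    rw [← Finset.sum_sub_distrib, Finset.mul_sum]
    refine Finset.sum_congr rfl fun k _ => ?_
    rw [← mul_assoc]
    exact X2_key _ _ _ _
  rw [e3, eQl, eQm', e1, e2, e4]
  ring
end
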